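/- arXiv:0903.3862 — 2 statements merged into one kernel-verified Lean document; each statement's English description precedes it below -/
import Mathlib

section
/- Let N be a positive integer, 𝔄 = [𝔞₁,…,𝔞ₙ] a tuple of elements of 𝔈, and F ∈ ℤ[X₁,…,Xₙ]. Then T_{𝔄,F} and T_{𝔄,F}∘B(1,1,1,−1) have rational Fourier coefficients: there exist sequences (c_n)_{n∈ℤ} and (c'_n)_{n∈ℤ} of rational numbers, each vanishing for all n below some bound, such that for all τ in the upper half-plane, T_{𝔄,F}(τ) = Σ_n c_n q^n and T_{𝔄,F}(B(1,1,1,−1)·τ) = Σ_n c'_n q^n, where q = e^{2πiτ/N}. -/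
open scoped MatrixGroups
open Complex

/-- The Weierstrass ℘-function of the lattice `L_τ = ℤ + ℤτ`. -/
noncomputable def wp (τ z : ℂ) : ℂ :=
  1 / z ^ 2 + ∑' p : {p : ℤ × ℤ // p ≠ 0},
    (1 / (z - ((p.1.1 : ℂ) + (p.1.2 : ℂ) * τ)) ^ 2 - 1 / ((p.1.1 : ℂ) + (p.1.2 : ℂ) * τ) ^ 2)

/-- The function `W_𝔞` for the triple `𝔞 = [a₁,a₂,a₃]`. -/
noncomputable def Wfun (N : ℕ) (a₁ a₂ a₃ : ℤ) (τ : ℂ) : ℂ :=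
  (wp τ ((a₁ : ℂ) / N) - wp τ ((a₃ : ℂ) / N)) / (wp τ ((a₂ : ℂ) / N) - wp τ ((a₃ : ℂ) / N))

/-- Möbius action of an integral 2×2 matrix on ℂ. -/
noncomputable def moebius (A : Matrix (Fin 2) (Fin 2) ℤ) (τ : ℂ) : ℂ :=
  ((A 0 0 : ℂ) * τ + (A 0 1 : ℂ)) / ((A 1 0 : ℂ) * τ + (A 1 1 : ℂ))

/-- `𝔖_N = (ℤ/Nℤ)ˣ/{±1}`. -/
abbrev SNgroup (N : ℕ) := (ZMod N)ˣ ⧸ (Subgroup.closure ({-1} : Set (ZMod N)ˣ))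

/-- The triple `𝔞 = [a₁,a₂,a₃]` is in `𝔈`. -/
def memE (N : ℕ) (a : ℤ × ℤ × ℤ) : Prop :=
  0 < a.1 ∧ 0 < a.2.1 ∧ 0 < a.2.2 ∧ 2 * a.1 ≤ (N : ℤ) ∧ 2 * a.2.1 ≤ (N : ℤ) ∧
    2 * a.2.2 ≤ (N : ℤ) ∧ a.1 ≠ a.2.1 ∧ a.1 ≠ a.2.2 ∧ a.2.1 ≠ a.2.2

def memE1 (N : ℕ) (a : ℤ × ℤ × ℤ) : Prop :=
  memE N a ∧ IsCoprime (a.1 * a.2.1 * a.2.2) (N : ℤ)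

def memE2 (N : ℕ) (a : ℤ × ℤ × ℤ) : Prop :=
  memE1 N a ∧ IsCoprime (a.1 - a.2.2) (N : ℤ) ∧ IsCoprime (a.1 + a.2.2) (N : ℤ) ∧
    IsCoprime (a.2.1 - a.2.2) (N : ℤ) ∧ IsCoprime (a.2.1 + a.2.2) (N : ℤ)

/-- `M` is a lift to `Γ₀(N)` of `diag(λ⁻¹, λ)` for the class `s = λ ∈ 𝔖_N`. -/
def IsDiagLift (N : ℕ) (M : SL(2, ℤ)) (s : SNgroup N) : Prop :=
  ∃ u : (ZMod N)ˣ, (QuotientGroup.mk u : SNgroup N) = s ∧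
    ((M 0 0 : ℤ) : ZMod N) = ((u⁻¹ : (ZMod N)ˣ) : ZMod N) ∧
    ((M 0 1 : ℤ) : ZMod N) = 0 ∧ ((M 1 0 : ℤ) : ZMod N) = 0 ∧
    ((M 1 1 : ℤ) : ZMod N) = (u : ZMod N)

/-- The function `T_{𝔄,F}`. -/
noncomputable def Tfun (N : ℕ) {n : ℕ} (A : Fin n → ℤ × ℤ × ℤ)
    (F : MvPolynomial (Fin n) ℤ) (M : SNgroup N → SL(2, ℤ)) (τ : ℂ) : ℂ :=
  ∑ᶠ s : SNgroup N, MvPolynomial.aeval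
    (fun i => Wfun N (A i).1 (A i).2.1 (A i).2.2 (moebius ((M s : SL(2, ℤ)) : Matrix (Fin 2) (Fin 2) ℤ) τ)) F

/-- The matrix `B(t,u,v,k)`. -/
def Bmat (t : ℕ) (u v k : ℤ) : Matrix (Fin 2) (Fin 2) ℤ :=
  !![u, (u * v - 1) / (t : ℤ) + u * k; (t : ℤ), v + (t : ℤ) * k]

/-- `{a}` : the representative of `±a mod N` in `(0, N/2]` (paper's `{·}`). -/
def red (N : ℕ) (a : ℤ) : ℤ :=
  if 2 * (a % (N : ℤ)) ≤ (N : ℤ) then a % (N : ℤ) else (N : ℤ) - a % (N : ℤ)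

/-- `μ(a) ∈ {±1}` with `a ≡ μ(a){a} mod N`. -/
def muSign (N : ℕ) (a : ℤ) : ℤ :=
  if 2 * (a % (N : ℤ)) ≤ (N : ℤ) then 1 else -1

/-- `φ_s(τ) = (2πi)⁻²℘(s/N; L_τ) − 1/12`. -/
noncomputable def phiFun (N : ℕ) (s : ℤ) (τ : ℂ) : ℂ :=
  (1 / (2 * (Real.pi : ℂ) * Complex.I) ^ 2) * wp τ ((s : ℂ) / N) - 1 / 12

/-- `f[A]₂` : weight-2 slash of `φ_s`. -/
noncomputable def phiSlash (N : ℕ) (s : ℤ) (A : Matrix (Fin 2) (Fin 2) ℤ) (τ : ℂ) : ℂ :=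
  phiFun N s (moebius A τ) * ((A 1 0 : ℂ) * τ + (A 1 1 : ℂ)) ^ (-2 : ℤ)

/-- `q = e^{2πiτ/N}`. -/
noncomputable def qq (N : ℕ) (τ : ℂ) : ℂ :=
  Complex.exp (2 * (Real.pi : ℂ) * Complex.I * τ / N)

/-- `ζ = e^{2πi/N}`. -/
noncomputable def zetaN (N : ℕ) : ℂ :=
  Complex.exp (2 * (Real.pi : ℂ) * Complex.I / N)

/-- `θ_{a,b} = ζ^a(1−ζ^{b−a})(1−ζ^{b+a})/((1−ζ^a)²(1−ζ^b)²)`. -/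
noncomputable def theta (ζ : ℂ) (a b : ℤ) : ℂ :=
  ζ ^ a * (1 - ζ ^ (b - a)) * (1 - ζ ^ (b + a)) / ((1 - ζ ^ a) ^ 2 * (1 - ζ ^ b) ^ 2)

/-- The infinite product `∏_{n ≥ 0} (1 - x Qⁿ)`. -/
noncomputable def qPoch (Q x : ℂ) : ℂ := ∏' n : ℕ, (1 - x * Q ^ n)

lemma summable_norm_mul_geometric {Q : ℂ} (hQ : ‖Q‖ < 1) (x : ℂ) :
    Summable fun n : ℕ => ‖-(x * Q ^ n)‖ := by
  simpa using (summable_geometric_of_lt_one (norm_nonneg _) hQ).mul_left ‖x‖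

lemma qPoch_ne_zero {Q x : ℂ} (hQ : ‖Q‖ < 1) (hx : ∀ n : ℕ, x * Q ^ n ≠ 1) :
    qPoch Q x ≠ 0 := by
  have := tprod_one_add_ne_zero_of_summable (f := fun n : ℕ => -(x * Q ^ n))
    (fun n h => hx n (by linear_combination -h)) (summable_norm_mul_geometric hQ x)
  simpa [qPoch, sub_eq_add_neg] using this

lemma qPoch_eq_mul {Q : ℂ} (hQ : ‖Q‖ < 1) (x : ℂ) :
    qPoch Q x = (1 - x) * qPoch Q (Q * x) := by
  have hm : Multipliable fun n : ℕ => 1 + -(x * Q ^ (n + 1)) :=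
    multipliable_one_add_of_summable
      ((summable_nat_add_iff 1).2 (summable_norm_mul_geometric hQ x))
  have h := hm.hasProd.zero_mul (f := fun n : ℕ => 1 + -(x * Q ^ n))
  rw [qPoch, qPoch]
  simp only [← sub_eq_add_neg] at h
  rw [h.tprod_eq]
  simp [pow_succ', mul_assoc, mul_left_comm]

lemma qPoch_differentiable {Q : ℂ} (hQ : ‖Q‖ < 1) : Differentiable ℂ (qPoch Q) := by
  have key : MultipliableLocallyUniformlyOn (fun (n : ℕ) x => 1 + -(x * Q ^ n))
      (Set.univ : Set ℂ) := by
    refine ⟨fun x => ∏' n : ℕ, (1 + -(x * Q ^ n)), ?_⟩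
    apply hasProdLocallyUniformlyOn_of_forall_compact isOpen_univ
    intro K _ hK
    obtain ⟨C, hC⟩ := hK.isBounded.exists_norm_le
    refine ((summable_geometric_of_lt_one (norm_nonneg _) hQ).mul_left
      C).hasProdUniformlyOn_nat_one_add
      hK (.of_forall fun n x hx => ?_) (fun _ => by fun_prop)
    simpa using mul_le_mul_of_nonneg_right (hC x hx) (by positivity)
  have hd := key.hasProdLocallyUniformlyOn.differentiableOn
    (.of_forall fun _ => by simpa [Finset.prod_fn] using
      DifferentiableOn.finsetProd (fun _ _ => by fun_prop)) isOpen_univ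
  have he : qPoch Q = fun x => ∏' n : ℕ, (1 + -(x * Q ^ n)) := by
    funext x
    simp [qPoch, sub_eq_add_neg]
  rw [he]
  exact differentiableOn_univ.1 hd

/-- The multiplicative theta function `∏_{n ≥ 0} (1 - u Qⁿ) (1 - u⁻¹ Qⁿ⁺¹)`. -/
noncomputable def thetaQ (Q u : ℂ) : ℂ := qPoch Q u * qPoch Q (Q * u⁻¹)

lemma thetaQ_eq {Q : ℂ} (hQ : ‖Q‖ < 1) (u : ℂ) :
    thetaQ Q u = (1 - u) * (qPoch Q (Q * u) * qPoch Q (Q * u⁻¹)) := by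
  rw [thetaQ, qPoch_eq_mul hQ u, mul_assoc]

lemma thetaQ_one {Q : ℂ} (hQ : ‖Q‖ < 1) : thetaQ Q 1 = 0 := by
  simp [thetaQ_eq hQ]

lemma thetaQ_inv {Q u : ℂ} (hQ : ‖Q‖ < 1) (hu : u ≠ 0) :
    thetaQ Q u⁻¹ = -u⁻¹ * thetaQ Q u := by
  rw [thetaQ_eq hQ, thetaQ_eq hQ, inv_inv]
  field_simp
  ring

lemma thetaQ_mul {Q u : ℂ} (hQ : ‖Q‖ < 1) (hQ0 : Q ≠ 0) (hu : u ≠ 0) :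
    thetaQ Q (Q * u) = -u⁻¹ * thetaQ Q u := by
  rw [← thetaQ_inv hQ hu, thetaQ, thetaQ, inv_inv, mul_comm]
  congr 2
  field_simp

lemma thetaQ_ne_zero {Q u : ℂ} (hQ : ‖Q‖ < 1) (hQ0 : Q ≠ 0) (hu0 : u ≠ 0)
    (hu : ∀ n : ℤ, u ≠ Q ^ n) : thetaQ Q u ≠ 0 := by
  refine mul_ne_zero (qPoch_ne_zero hQ fun n h => ?_) (qPoch_ne_zero hQ fun n h => ?_)
  · apply hu (-n)
    rw [zpow_neg, zpow_natCast]
    exact eq_inv_of_mul_eq_one_left h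
  · apply hu (n + 1)
    rw [zpow_add₀ hQ0, zpow_natCast, zpow_one]
    field_simp at h
    linear_combination -h

/-- The theta function of the lattice `ℤ + ℤτ`, vanishing exactly on the lattice. -/
noncomputable def thetaZ (τ z : ℂ) : ℂ :=
  thetaQ (exp (2 * Real.pi * I * τ)) (exp (2 * Real.pi * I * z))

lemma norm_nome_lt_one {τ : ℂ} (hτ : 0 < τ.im) : ‖exp (2 * Real.pi * I * τ)‖ < 1 := by
  rw [norm_exp]
  simp
  positivity

lemma thetaZ_neg {τ : ℂ} (hτ : 0 < τ.im) (z : ℂ) :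
    thetaZ τ (-z) = -exp (2 * Real.pi * I * (-z)) * thetaZ τ z := by
  have := thetaQ_inv (norm_nome_lt_one hτ) (exp_ne_zero (2 * Real.pi * I * z))
  rw [thetaZ, mul_neg, exp_neg, this]
  rfl

lemma thetaZ_add_one (τ z : ℂ) : thetaZ τ (z + 1) = thetaZ τ z := by
  rw [thetaZ, mul_add, mul_one, exp_add, exp_two_pi_mul_I, mul_one]
  rfl

lemma thetaZ_add_tau {τ : ℂ} (hτ : 0 < τ.im) (z : ℂ) :
    thetaZ τ (z + τ) = -exp (2 * Real.pi * I * (-z)) * thetaZ τ z := by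
  have := thetaQ_mul (norm_nome_lt_one hτ) (exp_ne_zero _) (exp_ne_zero (2 * Real.pi * I * z))
  rw [thetaZ, mul_add, exp_add, mul_comm (exp _), this, mul_neg, exp_neg]
  rfl

lemma thetaZ_zero {τ : ℂ} (hτ : 0 < τ.im) : thetaZ τ 0 = 0 := by
  simp [thetaZ, thetaQ_one (norm_nome_lt_one hτ)]

lemma thetaZ_differentiable {τ : ℂ} (hτ : 0 < τ.im) : Differentiable ℂ (thetaZ τ) := by
  have h := qPoch_differentiable (norm_nome_lt_one hτ)
  unfold thetaZ thetaQ
  simp only [← exp_neg]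
  refine (h.comp (g := qPoch _) (f := fun z => exp (2 * Real.pi * I * z)) (by fun_prop)).mul
    (h.comp (g := qPoch _) (f := fun z => exp (2 * Real.pi * I * τ) * exp (-(2 * Real.pi * I * z)))
      (by fun_prop))

/-- Membership in the lattice `ℤ + ℤτ`. -/
def InLat (τ z : ℂ) : Prop := ∃ m n : ℤ, z = m + n * τ

lemma thetaZ_ne_zero {τ z : ℂ} (hτ : 0 < τ.im) (hz : ¬ InLat τ z) : thetaZ τ z ≠ 0 := by
  refine thetaQ_ne_zero (norm_nome_lt_one hτ) (exp_ne_zero _) (exp_ne_zero _) fun n h => hz ?_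
  rw [← exp_int_mul, exp_eq_exp_iff_exists_int] at h
  obtain ⟨m, hm⟩ := h
  refine ⟨m, n, mul_left_cancel₀ two_pi_I_ne_zero ?_⟩
  linear_combination hm

lemma linearIndependent_one_tau {τ : ℂ} (hτ : 0 < τ.im) : LinearIndependent ℝ ![1, τ] := by
  rw [LinearIndependent.pair_iff]
  intro s t h
  have h1 := congrArg im h
  have h2 := congrArg re h
  simp at h1 h2
  have ht : t = 0 := h1.resolve_right hτ.ne'
  subst ht
  exact ⟨by simpa using h2, rfl⟩

/-- The pair of periods `(1, τ)`. -/
noncomputable def tauPair {τ : ℂ} (hτ : 0 < τ.im) : PeriodPair :=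
  ⟨1, τ, linearIndependent_one_tau hτ⟩

lemma mem_tauPair_lattice {τ z : ℂ} (hτ : 0 < τ.im) :
    z ∈ (tauPair hτ).lattice ↔ InLat τ z := by
  rw [PeriodPair.mem_lattice, InLat]
  simp [tauPair, eq_comm]

lemma tsum_ne_zero_eq_tsum {f : ℤ × ℤ → ℂ} (hf : Summable f) :
    f 0 + ∑' p : {p : ℤ × ℤ // p ≠ 0}, f p.1 = ∑' p, f p := by
  rw [← hf.tsum_subtype_add_tsum_subtype_compl {0}]
  congr 1
  simp

lemma hasSum_weierstrassP_tau {τ : ℂ} (hτ : 0 < τ.im) (z : ℂ) :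
    HasSum (fun p : ℤ × ℤ => 1 / (z - ((p.1 : ℂ) + (p.2 : ℂ) * τ)) ^ 2 -
      1 / ((p.1 : ℂ) + (p.2 : ℂ) * τ) ^ 2) ((tauPair hτ).weierstrassP z) := by
  have h := (tauPair hτ).hasSum_weierstrassP z
  rw [← (tauPair hτ).latticeEquivProd.symm.toEquiv.hasSum_iff] at h
  convert h using 2 with p
  have hp : ((tauPair hτ).latticeEquivProd.symm p : ℂ) = p.1 + p.2 * τ := by
    simpa [tauPair] using (tauPair hτ).latticeEquiv_symm_apply p
  simp only [Function.comp_apply, LinearEquiv.coe_toEquiv, hp]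

lemma wp_eq_tsum {τ : ℂ} (hτ : 0 < τ.im) (z : ℂ) :
    wp τ z = ∑' p : ℤ × ℤ, (1 / (z - ((p.1 : ℂ) + (p.2 : ℂ) * τ)) ^ 2 -
      1 / ((p.1 : ℂ) + (p.2 : ℂ) * τ) ^ 2) := by
  rw [← tsum_ne_zero_eq_tsum (hasSum_weierstrassP_tau hτ z).summable, wp]
  simp

lemma wp_eq_weierstrassP {τ : ℂ} (hτ : 0 < τ.im) : wp τ = (tauPair hτ).weierstrassP := by
  funext z
  rw [wp_eq_tsum hτ, (hasSum_weierstrassP_tau hτ z).tsum_eq]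

lemma wp_neg {τ : ℂ} (hτ : 0 < τ.im) (z : ℂ) : wp τ (-z) = wp τ z := by
  rw [wp_eq_weierstrassP hτ, PeriodPair.weierstrassP_neg]

lemma wp_add_lattice {τ l : ℂ} (hτ : 0 < τ.im) (hl : InLat τ l) (z : ℂ) :
    wp τ (z + l) = wp τ z := by
  rw [wp_eq_weierstrassP hτ]
  exact (tauPair hτ).weierstrassP_add_coe z ⟨l, (mem_tauPair_lattice hτ).2 hl⟩

lemma InLat.add {τ z w : ℂ} (hz : InLat τ z) (hw : InLat τ w) : InLat τ (z + w) := by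
  obtain ⟨m, n, rfl⟩ := hz
  obtain ⟨m', n', rfl⟩ := hw
  exact ⟨m + m', n + n', by push_cast; ring⟩

lemma InLat.neg {τ z : ℂ} (hz : InLat τ z) : InLat τ (-z) := by
  obtain ⟨m, n, rfl⟩ := hz
  exact ⟨-m, -n, by push_cast; ring⟩

lemma InLat.zero (τ : ℂ) : InLat τ 0 := ⟨0, 0, by simp⟩

lemma eventually_not_inLat {τ : ℂ} (hτ : 0 < τ.im) (z : ℂ) :
    ∀ᶠ x in nhdsWithin z {z}ᶜ, ¬ InLat τ x := by
  have h := (tauPair hτ).compl_lattice_sdiff_singleton_mem_nhds z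
  filter_upwards [mem_nhdsWithin_of_mem_nhds h, self_mem_nhdsWithin] with x hx hxz hl
  exact hx ⟨(mem_tauPair_lattice hτ).2 hl, hxz⟩

lemma exists_bound_of_periodic {τ : ℂ} (hτ : 0 < τ.im) {g : ℂ → ℂ} (hg : Continuous g)
    (hper : ∀ z l, InLat τ l → g (z + l) = g z) : Bornology.IsBounded (Set.range g) := by
  have hK : IsCompact ((fun p : ℝ × ℝ => (p.1 : ℂ) + p.2 * τ) '' (Set.Icc 0 1 ×ˢ Set.Icc 0 1)) :=
    (isCompact_Icc.prod isCompact_Icc).image (by fun_prop)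
  refine (hK.image hg).isBounded.subset ?_
  rintro _ ⟨z, rfl⟩
  set y : ℝ := z.im / τ.im with hy
  set x : ℝ := z.re - y * τ.re with hx
  have hz : z = x + y * τ := by
    apply Complex.ext
    · simp [hx]
    · simp [hy, hτ.ne']
  refine ⟨(Int.fract x : ℝ) + (Int.fract y : ℝ) * τ, ⟨(Int.fract x, Int.fract y),
    ⟨⟨Int.fract_nonneg _, (Int.fract_lt_one _).le⟩,
      ⟨Int.fract_nonneg _, (Int.fract_lt_one _).le⟩⟩, rfl⟩, ?_⟩
  rw [← hper _ (⌊x⌋ + ⌊y⌋ * τ) ⟨_, _, rfl⟩]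
  congr 1
  rw [hz]
  have e1 := congrArg (fun t : ℝ => (t : ℂ)) (Int.fract_add_floor x)
  have e2 := congrArg (fun t : ℝ => (t : ℂ)) (Int.fract_add_floor y)
  push_cast at e1 e2
  linear_combination e1 + τ * e2

/-- An elliptic function with removable singularities on the lattice is constant. -/
lemma elliptic_eq_const {τ : ℂ} (hτ : 0 < τ.im) {g : ℂ → ℂ} {k : ℂ}
    (hd : ∀ z, ¬ InLat τ z → DifferentiableAt ℂ g z)
    (hper : ∀ z l, ¬ InLat τ z → InLat τ l → g (z + l) = g z)
    (hlim : Filter.Tendsto g (nhdsWithin 0 {0}ᶜ) (nhds k)) (z : ℂ) (hz : ¬ InLat τ z) :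
    g z = k := by
  classical
  let G : ℂ → ℂ := fun z => if InLat τ z then k else g z
  have hGper : ∀ z l, InLat τ l → G (z + l) = G z := by
    intro z l hl
    have hiff : InLat τ (z + l) ↔ InLat τ z :=
      ⟨fun h => by simpa using h.add hl.neg, fun h => h.add hl⟩
    by_cases hz : InLat τ z
    · simp [G, hz, hiff.2 hz]
    · simp [G, hz, mt hiff.1 hz, hper z l hz hl]
  have hGd : Differentiable ℂ G := by
    have hoff : ∀ z, ¬ InLat τ z → DifferentiableAt ℂ G z := by
      intro z hz
      have hev : ∀ᶠ x in nhds z, ¬ InLat τ x := by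
        have h := (tauPair hτ).compl_lattice_sdiff_singleton_mem_nhds z
        filter_upwards [h] with x hx hl
        refine hx ⟨(mem_tauPair_lattice hτ).2 hl, ?_⟩
        rintro rfl
        exact hz hl
      refine (hd z hz).congr_of_eventuallyEq ?_
      filter_upwards [hev] with x hx
      simp [G, hx]
    have hzero : DifferentiableAt ℂ G 0 := by
      refine (analyticAt_of_differentiable_on_punctured_nhds_of_continuousAt ?_ ?_).differentiableAt
      · filter_upwards [eventually_not_inLat hτ 0] with x hx using hoff x hx
      · rw [continuousAt_iff_punctured_nhds]
        have hG0 : G 0 = k := if_pos (InLat.zero τ)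
        rw [hG0]
        refine hlim.congr' ?_
        filter_upwards [eventually_not_inLat hτ 0] with x hx
        simp [G, hx]
    intro z
    by_cases hz : InLat τ z
    · have hshift : G = fun x => G (x + -z) := by
        funext x
        exact (hGper x _ hz.neg).symm
      rw [hshift]
      have : DifferentiableAt ℂ G (z + -z) := by simpa using hzero
      exact this.comp (g := G) (f := fun x => x + -z) z (by fun_prop)
    · exact hoff z hz
  have hb := exists_bound_of_periodic hτ hGd.continuous hGper
  have := hGd.apply_eq_apply_of_bounded hb z 0
  simpa [G, hz, InLat.zero] using this

/-- The quotient `θ(z - w) θ(z + w) / θ(z)²`, an elliptic function of `z`. -/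
noncomputable def thetaQuot (τ w z : ℂ) : ℂ := thetaZ τ (z - w) * thetaZ τ (z + w) / thetaZ τ z ^ 2

lemma thetaQuot_neg {τ : ℂ} (hτ : 0 < τ.im) (w z : ℂ) :
    thetaQuot τ w (-z) = thetaQuot τ w z := by
  have e1 : -z - w = -(z + w) := by ring
  have e2 : -z + w = -(z - w) := by ring
  have e3 : exp (2 * Real.pi * I * -(z + w)) * exp (2 * Real.pi * I * -(z - w)) =
      exp (2 * Real.pi * I * -z) ^ 2 := by
    rw [← exp_add, ← exp_nat_mul]
    congr 1
    push_cast
    ring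
  have h0 := exp_ne_zero (2 * Real.pi * I * -z)
  rw [thetaQuot, thetaQuot, e1, e2, thetaZ_neg hτ, thetaZ_neg hτ, thetaZ_neg hτ, mul_pow, neg_sq,
    ← e3, ← mul_div_mul_left (thetaZ τ (z - w) * thetaZ τ (z + w)) _
      (mul_ne_zero (exp_ne_zero (2 * Real.pi * I * -(z + w)))
        (exp_ne_zero (2 * Real.pi * I * -(z - w))))]
  congr 1
  ring

lemma thetaQuot_add_one (τ w z : ℂ) : thetaQuot τ w (z + 1) = thetaQuot τ w z := by
  rw [thetaQuot, add_sub_right_comm, add_right_comm z 1 w, thetaZ_add_one, thetaZ_add_one,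
    thetaZ_add_one, thetaQuot]

lemma thetaQuot_add_tau {τ : ℂ} (hτ : 0 < τ.im) (w z : ℂ) :
    thetaQuot τ w (z + τ) = thetaQuot τ w z := by
  have e3 : exp (2 * Real.pi * I * -(z + w)) * exp (2 * Real.pi * I * -(z - w)) =
      exp (2 * Real.pi * I * -z) ^ 2 := by
    rw [← exp_add, ← exp_nat_mul]
    congr 1
    push_cast
    ring
  rw [thetaQuot, thetaQuot, add_sub_right_comm, add_right_comm z τ w, thetaZ_add_tau hτ,
    thetaZ_add_tau hτ, thetaZ_add_tau hτ, mul_pow, neg_sq,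
    ← e3, ← mul_div_mul_left (thetaZ τ (z - w) * thetaZ τ (z + w)) _
      (mul_ne_zero (exp_ne_zero (2 * Real.pi * I * -(z + w)))
        (exp_ne_zero (2 * Real.pi * I * -(z - w))))]
  congr 1
  ring

lemma periodic_of_periods {τ : ℂ} {g : ℂ → ℂ} (h1 : ∀ z, g (z + 1) = g z)
    (hτ : ∀ z, g (z + τ) = g z) (z l : ℂ) (hl : InLat τ l) : g (z + l) = g z := by
  obtain ⟨m, n, rfl⟩ := hl
  have p1 : Function.Periodic g 1 := h1
  have p2 : Function.Periodic g τ := hτ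
  have := (p2.int_mul n) (z + m)
  rw [← add_assoc, this]
  simpa using (p1.int_mul m) z

lemma exists_thetaZ_eq_mul {τ : ℂ} (hτ : 0 < τ.im) :
    ∃ k : ℂ → ℂ, Differentiable ℂ k ∧ k 0 ≠ 0 ∧ ∀ z, thetaZ τ z = z * k z := by
  have hQ := norm_nome_lt_one hτ
  have hP := qPoch_differentiable hQ
  set Q := exp (2 * Real.pi * I * τ) with hQdef
  have hQn : ∀ n : ℕ, Q * Q ^ n ≠ 1 := by
    intro n h
    have : ‖Q ^ (n + 1)‖ < 1 := by
      rw [norm_pow]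
      exact pow_lt_one₀ (norm_nonneg _) hQ (by simp)
    rw [pow_succ', h] at this
    simp at this
  have hE : Differentiable ℂ (fun z : ℂ => 1 - exp (2 * Real.pi * I * z)) := by fun_prop
  have hE' : HasDerivAt (fun z : ℂ => 1 - exp (2 * Real.pi * I * z)) (-(2 * Real.pi * I)) 0 := by
    have h := (((hasDerivAt_id (0 : ℂ)).const_mul (2 * Real.pi * I)).cexp).const_sub 1
    simpa using h
  refine ⟨fun z => dslope (fun z : ℂ => 1 - exp (2 * Real.pi * I * z)) 0 z *
    (qPoch Q (Q * exp (2 * Real.pi * I * z)) * qPoch Q (Q * (exp (2 * Real.pi * I * z))⁻¹)),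
    ?_, ?_, ?_⟩
  · refine Differentiable.mul ?_ (Differentiable.mul ?_ ?_)
    · rw [← differentiableOn_univ, differentiableOn_dslope Filter.univ_mem]
      exact hE.differentiableOn
    · exact hP.comp (g := qPoch Q) (f := fun z => Q * exp (2 * Real.pi * I * z)) (by fun_prop)
    · simp only [← exp_neg]
      exact hP.comp (g := qPoch Q) (f := fun z => Q * exp (-(2 * Real.pi * I * z))) (by fun_prop)
  · simp only [dslope_same, hE'.deriv]
    simpa [Real.pi_ne_zero] using qPoch_ne_zero hQ hQn
  · intro z
    have h := sub_smul_dslope (fun z : ℂ => 1 - exp (2 * Real.pi * I * z)) 0 z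
    simp only [sub_zero, smul_eq_mul, mul_zero, exp_zero, sub_self] at h
    rw [thetaZ, ← hQdef, thetaQ_eq hQ, ← h, mul_assoc]

lemma exists_thetaQuot_eq {τ : ℂ} (hτ : 0 < τ.im) (w : ℂ) :
    ∃ (a : ℂ) (l : ℂ → ℂ), ContinuousAt l 0 ∧
      ∀ z, z ≠ 0 → thetaQuot τ w z = a / z ^ 2 + l z := by
  obtain ⟨k, hk, hk0, hθ⟩ := exists_thetaZ_eq_mul hτ
  have hθd := thetaZ_differentiable hτ
  set h : ℂ → ℂ := fun z => thetaZ τ (z - w) * thetaZ τ (z + w) / k z ^ 2 with hh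
  have hhq : ∀ z, z ≠ 0 → h z = z ^ 2 * thetaQuot τ w z := by
    intro z hz
    rw [hh, thetaQuot, hθ z]
    field_simp
  have heven : ∀ z, h (-z) = h z := by
    intro z
    by_cases hz : z = 0
    · simp [hz]
    · rw [hhq z hz, hhq (-z) (neg_ne_zero.2 hz), thetaQuot_neg hτ, neg_sq]
  have han : AnalyticAt ℂ h 0 := by
    have hθa : ∀ z, AnalyticAt ℂ (thetaZ τ) z := fun z => hθd.analyticAt z
    refine AnalyticAt.div (AnalyticAt.mul ?_ ?_) ((hk.analyticAt 0).pow 2) (pow_ne_zero 2 hk0)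
    · exact (hθa _).comp (g := thetaZ τ) (f := fun z => z - w) (by fun_prop)
    · exact (hθa _).comp (g := thetaZ τ) (f := fun z => z + w) (by fun_prop)
  have hderiv : deriv h 0 = 0 := by
    have h1 : deriv (fun z => h (-z)) 0 = -deriv h 0 := by
      rw [deriv_comp_neg, neg_zero]
    rw [funext heven] at h1
    exact self_eq_neg.1 h1
  obtain ⟨p, hp⟩ := han
  have hl := hp.has_fpower_series_dslope_fslope.has_fpower_series_dslope_fslope
  refine ⟨h 0, dslope (dslope h 0) 0, hl.continuousAt, fun z hz => ?_⟩
  have e1 := sub_smul_dslope h 0 z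
  have e2 := sub_smul_dslope (dslope h 0) 0 z
  simp only [sub_zero, smul_eq_mul, dslope_same, hderiv] at e1 e2
  have e3 := hhq z hz
  field_simp
  linear_combination -e3 - e1 - z * e2

lemma exists_thetaQuot_eq_wp_sub {τ w : ℂ} (hτ : 0 < τ.im) (hw : ¬ InLat τ w) :
    ∃ c : ℂ, ∀ z, ¬ InLat τ z → thetaQuot τ w z = c * (wp τ z - wp τ w) := by
  obtain ⟨a, l, hl, hal⟩ := exists_thetaQuot_eq hτ w
  have hθd := thetaZ_differentiable hτ
  have hwp : ∀ z, z ≠ 0 → wp τ z = (tauPair hτ).weierstrassPExcept 0 z + 1 / z ^ 2 := by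
    intro z _
    have := (tauPair hτ).weierstrassPExcept_add 0 z
    rw [wp_eq_weierstrassP hτ, ← this]
    simp
  have hconst := elliptic_eq_const hτ (g := fun z => thetaQuot τ w z - a * wp τ z)
    (k := l 0 - a * (tauPair hτ).weierstrassPExcept 0 0) ?_ ?_ ?_
  · refine ⟨a, fun z hz => ?_⟩
    have h1 := hconst z hz
    have h2 := hconst w hw
    have h3 : thetaQuot τ w w = 0 := by simp [thetaQuot, thetaZ_zero hτ]
    linear_combination h1 - h2 + h3
  · intro z hz
    refine DifferentiableAt.sub ?_ (DifferentiableAt.const_mul ?_ a)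
    · refine DifferentiableAt.div ?_ ((hθd z).pow 2) (pow_ne_zero 2 (thetaZ_ne_zero hτ hz))
      refine DifferentiableAt.mul ?_ ?_
      · exact (hθd _).comp (g := thetaZ τ) (f := fun z => z - w) z (by fun_prop)
      · exact (hθd _).comp (g := thetaZ τ) (f := fun z => z + w) z (by fun_prop)
    · rw [wp_eq_weierstrassP hτ]
      refine (tauPair hτ).differentiableOn_weierstrassP.differentiableAt
        ((tauPair hτ).isClosed_lattice.isOpen_compl.mem_nhds ?_)
      exact fun h => hz ((mem_tauPair_lattice hτ).1 h)
  · intro z m _ hm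
    simp only [wp_add_lattice hτ hm z,
      periodic_of_periods (thetaQuot_add_one τ w) (thetaQuot_add_tau hτ w) z m hm]
  · have hcont : ContinuousAt (fun z => l z - a * (tauPair hτ).weierstrassPExcept 0 z) 0 :=
      hl.sub (((tauPair hτ).analyticAt_weierstrassPExcept 0).continuousAt.const_mul a)
    refine (hcont.tendsto.mono_left nhdsWithin_le_nhds).congr' ?_
    filter_upwards [self_mem_nhdsWithin] with z hz
    rw [hal z hz, hwp z hz]
    ring

/-- The quotient of differences of `℘`-values in terms of theta functions. -/
lemma wp_sub_div_wp_sub {τ z₁ z₂ w : ℂ} (hτ : 0 < τ.im) (hz₁ : ¬ InLat τ z₁)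
    (hz₂ : ¬ InLat τ z₂) (hw : ¬ InLat τ w) (hs : ¬ InLat τ (z₂ - w)) (ha : ¬ InLat τ (z₂ + w)) :
    (wp τ z₁ - wp τ w) / (wp τ z₂ - wp τ w) = thetaQuot τ w z₁ / thetaQuot τ w z₂ := by
  obtain ⟨c, hc⟩ := exists_thetaQuot_eq_wp_sub hτ hw
  have h2 : thetaQuot τ w z₂ ≠ 0 :=
    div_ne_zero (mul_ne_zero (thetaZ_ne_zero hτ hs) (thetaZ_ne_zero hτ ha))
      (pow_ne_zero 2 (thetaZ_ne_zero hτ hz₂))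
  have hc0 : c ≠ 0 := by
    rintro rfl
    exact h2 (by simpa using hc z₂ hz₂)
  rw [hc z₁ hz₁, hc z₂ hz₂, mul_div_mul_left _ _ hc0]

section Expansion

variable {K : Type*} [Field K] [Algebra ℚ K]

/-- A family of functions on the unit disc, indexed by the embeddings of `K`, whose power series
are the images of a single power series over `K`. -/
def HasExpansion (p : PowerSeries K) (g : (K →ₐ[ℚ] ℂ) → ℂ → ℂ) : Prop :=
  ∀ σ q, ‖q‖ < 1 → HasSum (fun m : ℕ => σ (p.coeff m) * q ^ m) (g σ q)

/-- A family of functions on the punctured unit disc, indexed by the embeddings of `K`, whose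
Laurent series with finite principal part are the images of a single Laurent series over `K`. -/
def HasLaurent (g : (K →ₐ[ℚ] ℂ) → ℂ → ℂ) : Prop :=
  ∃ (d : ℕ) (p : PowerSeries K), ∀ σ q, q ≠ 0 → ‖q‖ < 1 →
    HasSum (fun m : ℕ => σ (p.coeff m) * q ^ m) (q ^ d * g σ q)

lemma hasSum_cauchy_product {a b : ℕ → ℂ} {q A B : ℂ}
    (ha : HasSum (fun m => a m * q ^ m) A) (hb : HasSum (fun m => b m * q ^ m) B) :
    HasSum (fun m => (∑ x ∈ Finset.HasAntidiagonal.antidiagonal m, a x.1 * b x.2) * q ^ m)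
      (A * B) := by
  have h := summable_norm_sum_mul_antidiagonal_of_summable_norm ha.summable.norm hb.summable.norm
  have e := tsum_mul_tsum_eq_tsum_sum_antidiagonal_of_summable_norm ha.summable.norm
    hb.summable.norm
  rw [ha.tsum_eq, hb.tsum_eq] at e
  rw [e]
  refine HasSum.congr_fun h.of_norm.hasSum fun m => ?_
  rw [Finset.sum_mul]
  refine Finset.sum_congr rfl fun x hx => ?_
  rw [← Finset.HasAntidiagonal.mem_antidiagonal.1 hx, pow_add]
  ring

lemma HasLaurent.congr {g h : (K →ₐ[ℚ] ℂ) → ℂ → ℂ} (hg : HasLaurent g)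
    (he : ∀ σ q, q ≠ 0 → ‖q‖ < 1 → h σ q = g σ q) : HasLaurent h := by
  obtain ⟨d, p, hp⟩ := hg
  exact ⟨d, p, fun σ q hq0 hq => by rw [he σ q hq0 hq]; exact hp σ q hq0 hq⟩

lemma HasExpansion.hasLaurent {p : PowerSeries K} {g : (K →ₐ[ℚ] ℂ) → ℂ → ℂ}
    (h : HasExpansion p g) : HasLaurent g :=
  ⟨0, p, fun σ q _ hq => by simpa using h σ q hq⟩

lemma hasExpansion_C (x : K) : HasExpansion (PowerSeries.C x) fun σ _ => σ x := by
  intro σ q _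
  convert hasSum_single (f := fun m : ℕ => σ ((PowerSeries.C x).coeff m) * q ^ m) 0 ?_ using 1
  · simp
  · intro m hm
    simp [PowerSeries.coeff_C, hm]

lemma hasExpansion_X_pow (k : ℕ) :
    HasExpansion (PowerSeries.X ^ k : PowerSeries K) fun _ q => q ^ k := by
  intro σ q _
  convert hasSum_single
    (f := fun m : ℕ => σ ((PowerSeries.X ^ k : PowerSeries K).coeff m) * q ^ m) k ?_ using 1
  · simp
  · intro m hm
    simp [PowerSeries.coeff_X_pow, hm]

lemma HasLaurent.mul {g h : (K →ₐ[ℚ] ℂ) → ℂ → ℂ} (hg : HasLaurent g) (hh : HasLaurent h) :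
    HasLaurent fun σ q => g σ q * h σ q := by
  obtain ⟨d, p, hp⟩ := hg
  obtain ⟨e, r, hr⟩ := hh
  refine ⟨d + e, p * r, fun σ q hq0 hq => ?_⟩
  convert hasSum_cauchy_product (hp σ q hq0 hq) (hr σ q hq0 hq) using 1
  · simp [PowerSeries.coeff_mul]
  · ring

lemma HasLaurent.add {g h : (K →ₐ[ℚ] ℂ) → ℂ → ℂ} (hg : HasLaurent g) (hh : HasLaurent h) :
    HasLaurent fun σ q => g σ q + h σ q := by
  obtain ⟨d, p, hp⟩ := hg
  obtain ⟨e, r, hr⟩ := hh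
  refine ⟨d + e, PowerSeries.X ^ e * p + PowerSeries.X ^ d * r, fun σ q hq0 hq => ?_⟩
  have h1 := hasSum_cauchy_product (hasExpansion_X_pow e σ q hq) (hp σ q hq0 hq)
  have h2 := hasSum_cauchy_product (hasExpansion_X_pow d σ q hq) (hr σ q hq0 hq)
  convert h1.add h2 using 1
  · funext m
    simp only [map_add, PowerSeries.coeff_mul, map_sum, map_mul]
    ring
  · ring

lemma hasLaurent_zpow (k : ℤ) : HasLaurent fun (_ : K →ₐ[ℚ] ℂ) q => q ^ k := by
  refine ⟨k.natAbs, PowerSeries.X ^ (k + k.natAbs).toNat, fun σ q hq0 hq => ?_⟩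
  have h := hasExpansion_X_pow (K := K) (k + k.natAbs).toNat σ q hq
  convert h using 1
  show q ^ k.natAbs * q ^ k = q ^ (k + k.natAbs).toNat
  rw [← zpow_natCast, ← zpow_natCast, ← zpow_add₀ hq0]
  congr 1
  omega

lemma hasLaurent_aeval {n : ℕ} {g : Fin n → (K →ₐ[ℚ] ℂ) → ℂ → ℂ} (hg : ∀ i, HasLaurent (g i))
    (F : MvPolynomial (Fin n) ℤ) :
    HasLaurent fun σ q => MvPolynomial.aeval (fun i => g i σ q) F := by
  induction F using MvPolynomial.induction_on with
  | C a => exact (hasExpansion_C (a : K)).hasLaurent.congr fun σ q _ _ => by simp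
  | add p r hp hr => exact (hp.add hr).congr fun σ q _ _ => by simp
  | mul_X p i hp => exact (hp.mul (hg i)).congr fun σ q _ _ => by simp

lemma hasFPowerSeriesOnBall_of_hasSum {c : ℕ → ℂ} {G : ℂ → ℂ}
    (h : ∀ q : ℂ, ‖q‖ < 1 → HasSum (fun m => c m * q ^ m) (G q)) :
    HasFPowerSeriesOnBall G (FormalMultilinearSeries.ofScalars ℂ c) 0 1 := by
  refine ⟨ENNReal.le_of_forall_nnreal_lt fun r hr => ?_, one_pos, fun {y} hy => ?_⟩
  · apply FormalMultilinearSeries.le_radius_of_tendsto (l := 0)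
    have hr' : ‖((r : ℝ) : ℂ)‖ < 1 := by simpa using hr
    convert (h _ hr').summable.tendsto_atTop_zero.norm using 2 with i
    · simp
    · simp
  · have hy' : ‖y‖ < 1 := by
      rw [← ENNReal.coe_one, Metric.eball_coe] at hy
      simpa using hy
    simpa [FormalMultilinearSeries.ofScalars_apply_eq, mul_comm] using h y hy'

lemma coeff_eq_of_hasSum {c c' : ℕ → ℂ} {G : ℂ → ℂ}
    (h : ∀ q : ℂ, ‖q‖ < 1 → HasSum (fun m => c m * q ^ m) (G q))
    (h' : ∀ q : ℂ, ‖q‖ < 1 → HasSum (fun m => c' m * q ^ m) (G q)) : c = c' :=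
  FormalMultilinearSeries.ofScalars_series_injective ℂ ℂ
    ((hasFPowerSeriesOnBall_of_hasSum h).hasFPowerSeriesAt.eq_formalMultilinearSeries
      (hasFPowerSeriesOnBall_of_hasSum h').hasFPowerSeriesAt)

lemma exists_hasSum_inv {c : ℕ → ℂ} {G : ℂ → ℂ}
    (h : ∀ q : ℂ, ‖q‖ < 1 → HasSum (fun m => c m * q ^ m) (G q))
    (hG : ∀ q : ℂ, ‖q‖ < 1 → G q ≠ 0) :
    ∃ a : ℕ → ℂ, ∀ q : ℂ, ‖q‖ < 1 → HasSum (fun m => a m * q ^ m) (G q)⁻¹ := by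
  have hd : DifferentiableOn ℂ G (Metric.ball 0 1) := by
    have := (hasFPowerSeriesOnBall_of_hasSum h).differentiableOn
    rwa [← ENNReal.coe_one, Metric.eball_coe] at this
  have hi : DifferentiableOn ℂ (fun q => (G q)⁻¹) (Metric.ball 0 1) :=
    hd.inv fun q hq => hG q (by simpa using hq)
  have hi' := Complex.hasSum_taylorSeries_on_ball hi
  refine ⟨fun m => (m.factorial : ℂ)⁻¹ * iteratedDeriv m (fun q => (G q)⁻¹) 0, fun q hq => ?_⟩
  refine HasSum.congr_fun (hi' (z := q) (by simpa using hq)) fun m => ?_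
  simp only [sub_zero, smul_eq_mul]
  ring

lemma HasExpansion.inv {p : PowerSeries K} {g : (K →ₐ[ℚ] ℂ) → ℂ → ℂ} (h : HasExpansion p g)
    (hg : ∀ σ q, ‖q‖ < 1 → g σ q ≠ 0) : HasExpansion p⁻¹ fun σ q => (g σ q)⁻¹ := by
  intro σ q hq
  obtain ⟨a, ha⟩ := exists_hasSum_inv (h σ) (hg σ)
  have hp0 : PowerSeries.constantCoeff p ≠ 0 := by
    intro hp0
    have h0 := h σ 0 (by simp)
    refine hg σ 0 (by simp) (h0.unique ?_)
    convert hasSum_zero using 2 with m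
    rcases m with _ | m
    · simp [hp0]
    · simp
  have hmul : PowerSeries.map (σ : K →+* ℂ) p * PowerSeries.mk a = 1 := by
    ext m
    have h1 : ∀ q : ℂ, ‖q‖ < 1 → HasSum
        (fun m => (∑ x ∈ Finset.HasAntidiagonal.antidiagonal m, σ (p.coeff x.1) * a x.2) * q ^ m)
        1 := by
      intro q hq
      have := hasSum_cauchy_product (h σ q hq) (ha q hq)
      rwa [mul_inv_cancel₀ (hg σ q hq)] at this
    have h2 : ∀ q : ℂ, ‖q‖ < 1 →
        HasSum (fun m => (PowerSeries.coeff m (1 : PowerSeries ℂ)) * q ^ m) 1 := by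
      intro q _
      convert hasSum_single
        (f := fun m : ℕ => (PowerSeries.coeff m (1 : PowerSeries ℂ)) * q ^ m) 0 ?_ using 1
      · simp
      · intro m hm
        simp [PowerSeries.coeff_one, hm]
    have := congrFun (coeff_eq_of_hasSum h1 h2) m
    simpa [PowerSeries.coeff_mul] using this
  have hmul' : PowerSeries.map (σ : K →+* ℂ) p * PowerSeries.map (σ : K →+* ℂ) p⁻¹ = 1 := by
    rw [← map_mul, PowerSeries.mul_inv_cancel _ hp0, map_one]
  have heq : PowerSeries.mk a = PowerSeries.map (σ : K →+* ℂ) p⁻¹ := by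
    rw [mul_comm] at hmul
    exact left_inv_eq_right_inv hmul hmul'
  convert ha q hq using 2 with m
  have := congrArg (PowerSeries.coeff m) heq
  simp only [PowerSeries.coeff_mk, PowerSeries.coeff_map] at this
  rw [this]
  rfl

lemma hasExpansion_qPoch {N j : ℕ} (hN : 0 < N) (hj : 0 < j) (y : K) :
    ∃ p : PowerSeries K, HasExpansion p fun σ q => qPoch (q ^ N) (σ y * q ^ j) := by
  classical
  let e : Finset ℕ → ℕ := fun s => ∑ n ∈ s, (j + N * n)
  have hes : ∀ s m, e s = m → s ∈ (Finset.range (m + 1)).powerset := by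
    rintro s m rfl
    rw [Finset.mem_powerset]
    intro n hn
    have h1 : j + N * n ≤ e s :=
      Finset.single_le_sum (f := fun n => j + N * n) (fun _ _ => Nat.zero_le _) hn
    have h2 : n ≤ N * n := Nat.le_mul_of_pos_left n hN
    rw [Finset.mem_range]
    omega
  refine ⟨PowerSeries.mk fun m => ∑ s ∈ (Finset.range (m + 1)).powerset with e s = m,
    (-y) ^ s.card, fun σ q hq => ?_⟩
  have hqN : ‖q ^ N‖ < 1 := by
    rw [norm_pow]
    exact pow_lt_one₀ (norm_nonneg _) hq hN.ne'
  have hs := summable_finsetProd_of_summable_norm (summable_norm_mul_geometric hqN (σ y * q ^ j))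
  have ht := tprod_one_add hs
  have hsum := hs.hasSum
  rw [← ht, ← (Equiv.sigmaFiberEquiv e).hasSum_iff] at hsum
  have hval : qPoch (q ^ N) (σ y * q ^ j) =
      ∏' n : ℕ, (1 + -(σ y * q ^ j * (q ^ N) ^ n)) := by
    simp [qPoch, sub_eq_add_neg]
  simp only [hval]
  refine hsum.sigma fun m => ?_
  have hterm : ∀ s : Finset ℕ, ∏ n ∈ s, -(σ y * q ^ j * (q ^ N) ^ n) =
      (-σ y) ^ s.card * q ^ e s := by
    intro s
    rw [← Finset.prod_pow_eq_pow_sum, ← Finset.prod_const, ← Finset.prod_mul_distrib]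
    refine Finset.prod_congr rfl fun n _ => ?_
    rw [pow_add, pow_mul]
    ring
  have hfib : HasSum (fun x : {s // e s = m} => (-σ y) ^ x.1.card * q ^ e x.1)
      (∑ s ∈ (Finset.range (m + 1)).powerset with e s = m, (-σ y) ^ s.card * q ^ e s) := by
    have := hasSum_subtype_iff_indicator (s := {s : Finset ℕ | e s = m})
      (f := fun s : Finset ℕ => (-σ y) ^ s.card * q ^ e s)
      (a := ∑ s ∈ (Finset.range (m + 1)).powerset with e s = m, (-σ y) ^ s.card * q ^ e s)
    refine this.2 ?_
    have h3 := hasSum_sum_of_ne_finset_zero (L := SummationFilter.unconditional _)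
      (f := Set.indicator {s : Finset ℕ | e s = m}
        fun s : Finset ℕ => (-σ y) ^ s.card * q ^ e s)
      (s := (Finset.range (m + 1)).powerset.filter fun s => e s = m) ?_
    · convert h3 using 1
      refine Finset.sum_congr rfl fun s hs => ?_
      rw [Set.indicator_of_mem]
      exact (Finset.mem_filter.1 hs).2
    · intro s hs
      refine Set.indicator_of_notMem (fun h => hs ?_) _
      exact Finset.mem_filter.2 ⟨hes s m h, h⟩
  have hcoeff : σ (∑ s ∈ (Finset.range (m + 1)).powerset with e s = m, (-y) ^ s.card) * q ^ m =
      ∑ s ∈ (Finset.range (m + 1)).powerset with e s = m, (-σ y) ^ s.card * q ^ e s := by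
    simp only [map_sum, map_pow, map_neg, Finset.sum_mul]
    refine Finset.sum_congr rfl fun s hs => ?_
    rw [(Finset.mem_filter.1 hs).2]
  rw [PowerSeries.coeff_mk, hcoeff]
  exact HasSum.congr_fun hfib fun x => hterm _

end Expansion

section Modularity

/-- The quotient of differences of values of `℘` underlying `Wfun`, at arbitrary arguments. -/
noncomputable def wpRatio (τ z₁ z₂ w : ℂ) : ℂ := (wp τ z₁ - wp τ w) / (wp τ z₂ - wp τ w)

lemma linear_ne_zero {τ : ℂ} (hτ : 0 < τ.im) {a b c d : ℤ} (h : a * d - b * c = 1) :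
    (c : ℂ) * τ + d ≠ 0 := by
  intro h0
  have him : (c : ℝ) * τ.im = 0 := by simpa using congrArg Complex.im h0
  have hc : c = 0 := by
    rcases mul_eq_zero.1 him with h1 | h1
    · exact_mod_cast h1
    · exact absurd h1 hτ.ne'
  subst hc
  have hd : d = 0 := by
    have : (d : ℂ) = 0 := by simpa using h0
    exact_mod_cast this
  subst hd
  simp at h

lemma im_linear_div_pos {τ : ℂ} (hτ : 0 < τ.im) {a b c d : ℤ} (h : a * d - b * c = 1) :
    0 < (((a : ℂ) * τ + b) / ((c : ℂ) * τ + d)).im := by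
  have hj := linear_ne_zero hτ h
  have h' : (a : ℝ) * d - b * c = 1 := by exact_mod_cast h
  rw [Complex.div_im, ← sub_div]
  refine div_pos ?_ (Complex.normSq_pos.2 hj)
  have : ((a : ℂ) * τ + b).im * ((c : ℂ) * τ + d).re - ((a : ℂ) * τ + b).re * ((c : ℂ) * τ + d).im
      = τ.im * ((a : ℝ) * d - b * c) := by
    simp
    ring
  rw [this, h', mul_one]
  exact hτ

lemma wp_linear_div {τ : ℂ} (hτ : 0 < τ.im) {a b c d : ℤ} (h : a * d - b * c = 1) (z : ℂ) :
    wp (((a : ℂ) * τ + b) / ((c : ℂ) * τ + d)) z =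
      ((c : ℂ) * τ + d) ^ 2 * wp τ (((c : ℂ) * τ + d) * z) := by
  have hj := linear_ne_zero hτ h
  rw [wp_eq_tsum (im_linear_div_pos hτ h), wp_eq_tsum hτ, ← tsum_mul_left]
  let e : ℤ × ℤ ≃ ℤ × ℤ :=
    { toFun := fun p => (p.1 * d + p.2 * b, p.1 * c + p.2 * a)
      invFun := fun p => (p.1 * a - p.2 * b, p.2 * d - p.1 * c)
      left_inv := fun p => by
        ext <;> simp only
        · linear_combination p.1 * h
        · linear_combination p.2 * h
      right_inv := fun p => by
        ext <;> simp only
        · linear_combination p.1 * h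
        · linear_combination p.2 * h }
  refine Eq.trans (tsum_congr fun p => ?_) (e.tsum_eq _)
  have hscale : ∀ x : ℂ, 1 / x ^ 2 =
      ((c : ℂ) * τ + d) ^ 2 * (1 / (((c : ℂ) * τ + d) * x) ^ 2) := by
    intro x
    rw [mul_one_div, mul_pow, ← div_div, div_self (pow_ne_zero 2 hj)]
  have hl : (((e p).1 : ℤ) : ℂ) + (((e p).2 : ℤ) : ℂ) * τ = ((c : ℂ) * τ + d) *
      ((p.1 : ℂ) + (p.2 : ℂ) * (((a : ℂ) * τ + b) / ((c : ℂ) * τ + d))) := by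
    simp only [e, Equiv.coe_fn_mk]
    push_cast
    field_simp
    ring
  rw [hl, ← mul_sub, hscale (z - _), hscale ((p.1 : ℂ) + _), ← mul_sub]

lemma wpRatio_linear_div {τ : ℂ} (hτ : 0 < τ.im) {a b c d : ℤ} (h : a * d - b * c = 1)
    (z₁ z₂ w : ℂ) : wpRatio (((a : ℂ) * τ + b) / ((c : ℂ) * τ + d)) z₁ z₂ w =
      wpRatio τ (((c : ℂ) * τ + d) * z₁) (((c : ℂ) * τ + d) * z₂) (((c : ℂ) * τ + d) * w) := by
  simp only [wpRatio, wp_linear_div hτ h, ← mul_sub]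
  exact mul_div_mul_left _ _ (pow_ne_zero 2 (linear_ne_zero hτ h))

lemma Wfun_moebius {N : ℕ} (hN : 0 < N) {M : SL(2, ℤ)} {U : ℤ}
    (hc : ((M 1 0 : ℤ) : ZMod N) = 0) (hd : ((M 1 1 : ℤ) : ZMod N) = U)
    {τ : ℂ} (hτ : 0 < τ.im) (a₁ a₂ a₃ : ℤ) :
    Wfun N a₁ a₂ a₃ (moebius (M : Matrix (Fin 2) (Fin 2) ℤ) τ) =
      wpRatio τ (a₁ * U / N) (a₂ * U / N) (a₃ * U / N) := by
  have hdet : M 0 0 * M 1 1 - M 0 1 * M 1 0 = 1 := by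
    rw [← Matrix.det_fin_two]
    exact M.det_coe
  have hN' : (N : ℂ) ≠ 0 := by exact_mod_cast hN.ne'
  obtain ⟨c', hc'⟩ := (ZMod.intCast_zmod_eq_zero_iff_dvd _ N).1 hc
  obtain ⟨d', hd'⟩ := (ZMod.intCast_eq_intCast_iff_dvd_sub _ _ N).1 hd.symm
  have key : ∀ a : ℤ, wp τ (((M 1 0 : ℤ) * τ + (M 1 1 : ℤ)) * (a / N)) = wp τ (a * U / N) := by
    intro a
    rw [← wp_add_lattice hτ (l := ((a * d' : ℤ) : ℂ) + ((a * c' : ℤ) : ℂ) * τ) ⟨_, _, rfl⟩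
      (a * U / N)]
    congr 1
    have h1 : ((M 1 0 : ℤ) : ℂ) = N * c' := by rw [hc']; push_cast; ring
    have h2 : ((M 1 1 : ℤ) : ℂ) = U + N * d' := by
      rw [← sub_add_cancel (M 1 1) U, hd']; push_cast; ring
    rw [h1, h2]
    push_cast
    field_simp
    ring
  have := wpRatio_linear_div hτ hdet (a₁ / N) (a₂ / N) (a₃ / N)
  rw [wpRatio, wpRatio, key, key, key] at this
  exact this

lemma Bmat_one_one_one_neg_one : Bmat 1 1 1 (-1) = !![1, -1; 1, 0] := by
  simp [Bmat]

lemma im_moebius_Bmat_pos {τ : ℂ} (hτ : 0 < τ.im) :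
    0 < (moebius (Bmat 1 1 1 (-1)) τ).im := by
  have := im_linear_div_pos hτ (a := 1) (b := -1) (c := 1) (d := 0) (by norm_num)
  simpa [moebius, Bmat_one_one_one_neg_one] using this

lemma wpRatio_moebius_Bmat {τ : ℂ} (hτ : 0 < τ.im) (z₁ z₂ w : ℂ) :
    wpRatio (moebius (Bmat 1 1 1 (-1)) τ) z₁ z₂ w = wpRatio τ (τ * z₁) (τ * z₂) (τ * w) := by
  have := wpRatio_linear_div hτ (a := 1) (b := -1) (c := 1) (d := 0) (by norm_num) z₁ z₂ w
  simpa [moebius, Bmat_one_one_one_neg_one] using this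

lemma not_inLat_div {N : ℕ} (hN : 0 < N) {τ : ℂ} (hτ : 0 < τ.im) {k : ℤ} (hk : ¬ (N : ℤ) ∣ k) :
    ¬ InLat τ ((k : ℂ) / N) := by
  rintro ⟨m, n, h⟩
  have hN' : (N : ℂ) ≠ 0 := by exact_mod_cast hN.ne'
  have hn : n = 0 := by
    have him : ((n : ℝ)) * τ.im = 0 := by
      have := congrArg Complex.im h
      rw [← Complex.ofReal_intCast, ← Complex.ofReal_natCast, ← Complex.ofReal_div] at this
      simpa [eq_comm, hτ.ne'] using this
    rcases mul_eq_zero.1 him with h1 | h1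
    · exact_mod_cast h1
    · exact absurd h1 hτ.ne'
  subst hn
  refine hk ⟨m, ?_⟩
  rw [div_eq_iff hN'] at h
  have : (k : ℂ) = ((N * m : ℤ) : ℂ) := by rw [h]; push_cast; ring
  exact_mod_cast this

lemma not_inLat_mul_div {N : ℕ} (hN : 0 < N) {τ : ℂ} (hτ : 0 < τ.im) {k : ℤ}
    (hk : ¬ (N : ℤ) ∣ k) : ¬ InLat τ (τ * ((k : ℂ) / N)) := by
  rintro ⟨m, n, h⟩
  have hN' : (N : ℝ) ≠ 0 := by exact_mod_cast hN.ne'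
  refine hk ⟨n, ?_⟩
  have him := congrArg Complex.im h
  rw [← Complex.ofReal_intCast k, ← Complex.ofReal_natCast N, ← Complex.ofReal_div,
    Complex.im_mul_ofReal] at him
  have h2 : τ.im * ((k : ℝ) / N) = τ.im * n := by rw [him]; simp [mul_comm]
  have h3 := mul_left_cancel₀ hτ.ne' h2
  rw [div_eq_iff hN'] at h3
  have : (k : ℝ) = ((N * n : ℤ) : ℝ) := by rw [h3]; push_cast; ring
  exact_mod_cast this

end Modularity

section LaurentUnit

variable {K : Type*} [Field K] [Algebra ℚ K]

/-- A family with a Laurent expansion whose inverse also has one. -/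
def HasLaurentUnit (g : (K →ₐ[ℚ] ℂ) → ℂ → ℂ) : Prop :=
  HasLaurent g ∧ HasLaurent fun σ q => (g σ q)⁻¹

lemma HasLaurentUnit.congr {g h : (K →ₐ[ℚ] ℂ) → ℂ → ℂ} (hg : HasLaurentUnit g)
    (he : ∀ σ q, q ≠ 0 → ‖q‖ < 1 → h σ q = g σ q) : HasLaurentUnit h :=
  ⟨hg.1.congr he, hg.2.congr fun σ q hq0 hq => by rw [he σ q hq0 hq]⟩

lemma HasLaurentUnit.mul {g h : (K →ₐ[ℚ] ℂ) → ℂ → ℂ} (hg : HasLaurentUnit g)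
    (hh : HasLaurentUnit h) : HasLaurentUnit fun σ q => g σ q * h σ q :=
  ⟨hg.1.mul hh.1, (hg.2.mul hh.2).congr fun _ _ _ _ => mul_inv _ _⟩

lemma HasLaurentUnit.inv {g : (K →ₐ[ℚ] ℂ) → ℂ → ℂ} (hg : HasLaurentUnit g) :
    HasLaurentUnit fun σ q => (g σ q)⁻¹ :=
  ⟨hg.2, hg.1.congr fun _ _ _ _ => inv_inv _⟩

lemma HasLaurentUnit.div {g h : (K →ₐ[ℚ] ℂ) → ℂ → ℂ} (hg : HasLaurentUnit g)
    (hh : HasLaurentUnit h) : HasLaurentUnit fun σ q => g σ q / h σ q :=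
  (hg.mul hh.inv).congr fun _ _ _ _ => div_eq_mul_inv _ _

lemma HasLaurentUnit.pow_two {g : (K →ₐ[ℚ] ℂ) → ℂ → ℂ} (hg : HasLaurentUnit g) :
    HasLaurentUnit fun σ q => g σ q ^ 2 :=
  (hg.mul hg).congr fun _ _ _ _ => sq _

lemma hasLaurentUnit_const (x : K) : HasLaurentUnit fun (σ : K →ₐ[ℚ] ℂ) _ => σ x :=
  ⟨(hasExpansion_C x).hasLaurent,
    (hasExpansion_C x⁻¹).hasLaurent.congr fun σ _ _ _ => (map_inv₀ σ x).symm⟩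

lemma hasLaurentUnit_zpow (k : ℤ) : HasLaurentUnit fun (_ : K →ₐ[ℚ] ℂ) q => q ^ k :=
  ⟨hasLaurent_zpow k, (hasLaurent_zpow (-k)).congr fun _ q _ _ => (zpow_neg q k).symm⟩

lemma hasLaurentUnit_qPoch {N j : ℕ} (hN : 0 < N) (hj : 0 < j) {y : K}
    (hy : ∀ σ : K →ₐ[ℚ] ℂ, ‖σ y‖ = 1) :
    HasLaurentUnit fun (σ : K →ₐ[ℚ] ℂ) q => qPoch (q ^ N) (σ y * q ^ j) := by
  obtain ⟨p, hp⟩ := hasExpansion_qPoch hN hj y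
  refine ⟨hp.hasLaurent, (hp.inv fun σ q hq => ?_).hasLaurent⟩
  refine qPoch_ne_zero ?_ fun n h => ?_
  · rw [norm_pow]
    exact pow_lt_one₀ (norm_nonneg _) hq hN.ne'
  · have hn := congrArg norm h
    rw [← pow_mul, mul_assoc, ← pow_add, norm_mul, hy, one_mul, norm_pow, norm_one] at hn
    exact (pow_lt_one₀ (norm_nonneg _) hq (by omega)).ne hn

lemma norm_map_eq_one {N : ℕ} (hN : 0 < N) {y : K} (hy : y ^ N = 1) (σ : K →ₐ[ℚ] ℂ) :
    ‖σ y‖ = 1 :=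
  norm_eq_one_of_pow_eq_one (by rw [← map_pow, hy, map_one]) hN.ne'

lemma hasLaurentUnit_thetaQ_const {N : ℕ} (hN : 0 < N) {y : K} (hy : y ^ N = 1) :
    HasLaurentUnit fun (σ : K →ₐ[ℚ] ℂ) q => thetaQ (q ^ N) (σ y) := by
  refine ((hasLaurentUnit_const (1 - y)).mul ((hasLaurentUnit_qPoch hN hN
    (norm_map_eq_one hN hy)).mul (hasLaurentUnit_qPoch hN hN (y := y⁻¹)
      (norm_map_eq_one hN (by rw [inv_pow, hy, inv_one]))))).congr fun σ q _ hq => ?_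
  rw [thetaQ_eq (by rw [norm_pow]; exact pow_lt_one₀ (norm_nonneg _) hq hN.ne')]
  simp [mul_comm]

lemma hasLaurentUnit_thetaQ_zpow {N : ℕ} (hN : 0 < N) {b : ℤ} (hb : ¬ (N : ℤ) ∣ b) :
    HasLaurentUnit fun (_ : K →ₐ[ℚ] ℂ) q => thetaQ (q ^ N) (q ^ b) := by
  have hN' : (N : ℤ) ≠ 0 := by exact_mod_cast hN.ne'
  have hnorm : ∀ q : ℂ, ‖q‖ < 1 → ‖q ^ N‖ < 1 := fun q hq => by
    rw [norm_pow]; exact pow_lt_one₀ (norm_nonneg _) hq hN.ne'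
  have hshift : ∀ (b : ℤ) (q : ℂ), q ≠ 0 → ‖q‖ < 1 →
      thetaQ (q ^ N) (q ^ (b + N)) = -q ^ (-b) * thetaQ (q ^ N) (q ^ b) := by
    intro b q hq0 hq
    rw [zpow_add₀ hq0, zpow_natCast, mul_comm (q ^ b),
      thetaQ_mul (hnorm q hq) (pow_ne_zero N hq0) (zpow_ne_zero b hq0), zpow_neg]
  have hneg : ∀ k : ℤ, HasLaurentUnit fun (_ : K →ₐ[ℚ] ℂ) q => -q ^ k := fun k =>
    ((hasLaurentUnit_const (-1)).mul (hasLaurentUnit_zpow k)).congr fun _ _ _ _ => by simp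
  have hbase : ∀ r : ℕ, 0 < r → r < N →
      HasLaurentUnit fun (_ : K →ₐ[ℚ] ℂ) q => thetaQ (q ^ N) (q ^ (r : ℤ)) := by
    intro r hr hrN
    refine ((hasLaurentUnit_qPoch hN hr (y := 1) (by simp)).mul
      (hasLaurentUnit_qPoch hN (Nat.sub_pos_of_lt hrN) (y := 1) (by simp))).congr
        fun σ q hq0 _ => ?_
    rw [thetaQ, zpow_natCast, pow_sub₀ q hq0 hrN.le]
    simp
  have hstep : ∀ k r : ℤ, 0 < r → r < N →
      HasLaurentUnit fun (_ : K →ₐ[ℚ] ℂ) q => thetaQ (q ^ N) (q ^ (r + N * k)) := by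
    intro k r hr hrN
    induction k using Int.induction_on with
    | zero =>
      lift r to ℕ using hr.le
      simpa using hbase r (by exact_mod_cast hr) (by exact_mod_cast hrN)
    | succ k ih =>
      refine ((hneg (-(r + N * k))).mul ih).congr fun σ q hq0 hq => ?_
      rw [← hshift _ q hq0 hq]
      ring_nf
    | pred k ih =>
      refine ((hneg (r + N * (-k - 1))).mul ih).congr fun σ q hq0 hq => ?_
      have h := hshift (r + N * (-k - 1)) q hq0 hq
      rw [show r + (N : ℤ) * (-k - 1) + N = r + N * -k by ring] at h
      rw [h, zpow_neg, ← mul_assoc, neg_mul_neg, mul_inv_cancel₀ (zpow_ne_zero _ hq0), one_mul]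
  have hr : 0 < b % N := lt_of_le_of_ne (Int.emod_nonneg b hN')
    fun h => hb (Int.dvd_of_emod_eq_zero h.symm)
  simpa [Int.emod_add_mul_ediv] using
    hstep (b / N) (b % N) hr (Int.emod_lt_of_pos b (by exact_mod_cast hN))

/-- The quotient of theta values expressing `wpRatio` at multiples of one point. -/
noncomputable def thetaRatio (Q x : ℂ) (b₁ b₂ b₃ : ℤ) : ℂ :=
  thetaQ Q (x ^ (b₁ - b₃)) * thetaQ Q (x ^ (b₁ + b₃)) / thetaQ Q (x ^ b₁) ^ 2 /
    (thetaQ Q (x ^ (b₂ - b₃)) * thetaQ Q (x ^ (b₂ + b₃)) / thetaQ Q (x ^ b₂) ^ 2)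

lemma wpRatio_eq_thetaRatio {τ z : ℂ} (hτ : 0 < τ.im) {b₁ b₂ b₃ : ℤ}
    (h₁ : ¬ InLat τ (b₁ * z)) (h₂ : ¬ InLat τ (b₂ * z)) (h₃ : ¬ InLat τ (b₃ * z))
    (hs : ¬ InLat τ ((b₂ - b₃ : ℤ) * z)) (ha : ¬ InLat τ ((b₂ + b₃ : ℤ) * z)) :
    wpRatio τ (b₁ * z) (b₂ * z) (b₃ * z) =
      thetaRatio (exp (2 * Real.pi * I * τ)) (exp (2 * Real.pi * I * z)) b₁ b₂ b₃ := by
  push_cast at hs ha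
  rw [sub_mul] at hs
  rw [add_mul] at ha
  rw [wpRatio, wp_sub_div_wp_sub hτ h₁ h₂ h₃ hs ha]
  simp only [thetaQuot, thetaZ, thetaRatio, ← exp_int_mul]
  push_cast
  ring_nf

lemma hasLaurent_thetaRatio {N : ℕ} {x : (K →ₐ[ℚ] ℂ) → ℂ → ℂ}
    (hx : ∀ b : ℤ, ¬ (N : ℤ) ∣ b → HasLaurentUnit fun σ q => thetaQ (q ^ N) (x σ q ^ b))
    {b₁ b₂ b₃ : ℤ} (h₁ : ¬ (N : ℤ) ∣ b₁) (h₂ : ¬ (N : ℤ) ∣ b₂)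
    (hs₁ : ¬ (N : ℤ) ∣ b₁ - b₃) (ha₁ : ¬ (N : ℤ) ∣ b₁ + b₃)
    (hs₂ : ¬ (N : ℤ) ∣ b₂ - b₃) (ha₂ : ¬ (N : ℤ) ∣ b₂ + b₃) :
    HasLaurent fun σ q => thetaRatio (q ^ N) (x σ q) b₁ b₂ b₃ :=
  ((((hx _ hs₁).mul (hx _ ha₁)).div (hx _ h₁).pow_two).div
    (((hx _ hs₂).mul (hx _ ha₂)).div (hx _ h₂).pow_two)).1

end LaurentUnit

section Assembly

variable {N n : ℕ}

/-- The value of `F` at the quotients `wpRatio` for the triples in `A`, scaled by `z`. -/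
noncomputable def wpPoly (A : Fin n → ℤ × ℤ × ℤ) (F : MvPolynomial (Fin n) ℤ) (τ z : ℂ) : ℂ :=
  MvPolynomial.aeval
    (fun i => wpRatio τ ((A i).1 * z) ((A i).2.1 * z) ((A i).2.2 * z)) F

/-- The value of `F` at the quotients `thetaRatio` for the triples in `A`. -/
noncomputable def thetaPoly (A : Fin n → ℤ × ℤ × ℤ) (F : MvPolynomial (Fin n) ℤ) (Q x : ℂ) : ℂ :=
  MvPolynomial.aeval (fun i => thetaRatio Q x (A i).1 (A i).2.1 (A i).2.2) F

lemma memE.not_dvd {a : ℤ × ℤ × ℤ} (h : memE N a) :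
    ¬ (N : ℤ) ∣ a.1 ∧ ¬ (N : ℤ) ∣ a.2.1 ∧ ¬ (N : ℤ) ∣ a.2.2 ∧ ¬ (N : ℤ) ∣ a.1 - a.2.2 ∧
      ¬ (N : ℤ) ∣ a.1 + a.2.2 ∧ ¬ (N : ℤ) ∣ a.2.1 - a.2.2 ∧ ¬ (N : ℤ) ∣ a.2.1 + a.2.2 := by
  have key : ∀ x : ℤ, x ≠ 0 → |x| < N → ¬ (N : ℤ) ∣ x := fun x hx hlt hd =>
    hx (Int.eq_zero_of_abs_lt_dvd hd hlt)
  obtain ⟨h1, h2, h3, h4, h5, h6, h7, h8, h9⟩ := h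
  refine ⟨?_, ?_, ?_, ?_, ?_, ?_, ?_⟩ <;> refine key _ (by omega) ?_ <;> rw [abs_lt] <;> omega

lemma wpPoly_eq_thetaPoly {A : Fin n → ℤ × ℤ × ℤ} (hA : ∀ i, memE N (A i))
    (F : MvPolynomial (Fin n) ℤ) {τ z : ℂ} (hτ : 0 < τ.im)
    (hz : ∀ b : ℤ, ¬ (N : ℤ) ∣ b → ¬ InLat τ (b * z)) :
    wpPoly A F τ z = thetaPoly A F (exp (2 * Real.pi * I * τ)) (exp (2 * Real.pi * I * z)) := by
  unfold wpPoly thetaPoly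
  congr 2
  funext i
  obtain ⟨h1, h2, h3, -, -, h6, h7⟩ := (hA i).not_dvd
  exact wpRatio_eq_thetaRatio hτ (hz _ h1) (hz _ h2) (hz _ h3) (hz _ h6) (hz _ h7)

lemma hasLaurent_thetaPoly {K : Type*} [Field K] [Algebra ℚ K] {A : Fin n → ℤ × ℤ × ℤ}
    (hA : ∀ i, memE N (A i)) (F : MvPolynomial (Fin n) ℤ) {x : (K →ₐ[ℚ] ℂ) → ℂ → ℂ}
    (hx : ∀ b : ℤ, ¬ (N : ℤ) ∣ b → HasLaurentUnit fun σ q => thetaQ (q ^ N) (x σ q ^ b)) :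
    HasLaurent fun σ q => thetaPoly A F (q ^ N) (x σ q) := by
  refine hasLaurent_aeval (fun i => ?_) F
  obtain ⟨h1, h2, -, h4, h5, h6, h7⟩ := (hA i).not_dvd
  exact hasLaurent_thetaRatio hx h1 h2 h4 h5 h6 h7

lemma wpPoly_congr (hN : 0 < N) (A : Fin n → ℤ × ℤ × ℤ) (F : MvPolynomial (Fin n) ℤ) {τ : ℂ}
    (hτ : 0 < τ.im) {U V : ℤ} (h : (N : ℤ) ∣ V - U ∨ (N : ℤ) ∣ V + U) :
    wpPoly A F τ (U / N) = wpPoly A F τ (V / N) := by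
  have hN' : (N : ℂ) ≠ 0 := by exact_mod_cast hN.ne'
  have key : ∀ a : ℤ, wp τ (a * (U / N)) = wp τ (a * (V / N)) := by
    intro a
    rcases h with ⟨k, hk⟩ | ⟨k, hk⟩
    · obtain rfl : V = U + N * k := by linarith
      rw [← wp_add_lattice hτ (l := ((a * k : ℤ) : ℂ)) ⟨a * k, 0, by simp⟩ (a * (U / N))]
      congr 1
      push_cast
      field_simp
    · obtain rfl : V = -U + N * k := by linarith
      rw [← wp_neg hτ (a * (U / N)),
        ← wp_add_lattice hτ (l := ((a * k : ℤ) : ℂ)) ⟨a * k, 0, by simp⟩ (-(a * (U / N)))]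
      congr 1
      push_cast
      field_simp
  simp only [wpPoly, wpRatio, key]

lemma Tfun_eq_finsum_wpPoly (hN : 0 < N) (A : Fin n → ℤ × ℤ × ℤ) (F : MvPolynomial (Fin n) ℤ)
    {M : SNgroup N → SL(2, ℤ)} (hM : ∀ s, IsDiagLift N (M s) s) :
    ∃ u : SNgroup N → (ZMod N)ˣ, (∀ s, (QuotientGroup.mk (u s) : SNgroup N) = s) ∧
      ∀ τ : ℂ, 0 < τ.im →
        Tfun N A F M τ = ∑ᶠ s, wpPoly A F τ ((((u s : ZMod N).val : ℤ) : ℂ) / N) := by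
  have : NeZero N := ⟨hN.ne'⟩
  choose u hu h00 h01 h10 h11 using hM
  refine ⟨u, hu, fun τ hτ => finsum_congr fun s => ?_⟩
  unfold wpPoly
  congr 2
  funext i
  rw [Wfun_moebius hN (h10 s) (U := ((u s : ZMod N).val : ℤ)) (by simp [h11]) hτ]
  simp only [mul_div_assoc]

lemma eq_or_eq_neg_of_mk_eq {u v : (ZMod N)ˣ}
    (h : (QuotientGroup.mk u : SNgroup N) = QuotientGroup.mk v) : v = u ∨ v = -u := by
  rw [QuotientGroup.eq] at h
  have key : ∀ x ∈ Subgroup.closure ({-1} : Set (ZMod N)ˣ), x = 1 ∨ x = -1 := by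
    intro x hx
    induction hx using Subgroup.closure_induction with
    | mem x hx => exact Or.inr hx
    | one => exact Or.inl rfl
    | mul x y _ _ hx hy => rcases hx with rfl | rfl <;> rcases hy with rfl | rfl <;> simp
    | inv x _ hx => rcases hx with rfl | rfl <;> simp
  rcases key _ h with h | h
  · exact Or.inl (inv_mul_eq_one.1 h).symm
  · exact Or.inr (by rw [inv_mul_eq_iff_eq_mul] at h; simpa using h)

lemma wpPoly_unit_congr [NeZero N] (A : Fin n → ℤ × ℤ × ℤ) (F : MvPolynomial (Fin n) ℤ) {τ : ℂ}
    (hτ : 0 < τ.im) {u v : (ZMod N)ˣ}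
    (h : (QuotientGroup.mk u : SNgroup N) = QuotientGroup.mk v) :
    wpPoly A F τ ((((u : ZMod N).val : ℤ) : ℂ) / N) =
      wpPoly A F τ ((((v : ZMod N).val : ℤ) : ℂ) / N) := by
  refine wpPoly_congr (NeZero.pos N) A F hτ ?_
  simp only [← ZMod.intCast_zmod_eq_zero_iff_dvd]
  rcases eq_or_eq_neg_of_mk_eq h with rfl | rfl
  · left; simp
  · right; simp

lemma sum_mk_eq {G : Type*} [Group G] [Fintype G] (H : Subgroup G) [Fintype (G ⧸ H)]
    (f : G ⧸ H → ℂ) : ∑ g : G, f (QuotientGroup.mk g) = Nat.card H * ∑ x, f x := by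
  have := Fintype.ofFinite H
  rw [← (Subgroup.groupEquivQuotientProdSubgroup (s := H)).symm.sum_comp, Fintype.sum_prod_type,
    Finset.mul_sum]
  refine Finset.sum_congr rfl fun x _ => ?_
  have : ∀ y : H, f (QuotientGroup.mk (Subgroup.groupEquivQuotientProdSubgroup.symm (x, y))) =
      f x := by
    intro y
    congr 1
    exact congrArg Prod.fst (Subgroup.groupEquivQuotientProdSubgroup.apply_symm_apply (x, y))
  simp [this, Nat.card_eq_fintype_card]

lemma not_dvd_mul_unit_val [NeZero N] (u : (ZMod N)ˣ) {b : ℤ} (hb : ¬ (N : ℤ) ∣ b) :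
    ¬ (N : ℤ) ∣ b * ((u : ZMod N).val : ℤ) := by
  intro h
  refine hb (IsCoprime.dvd_of_dvd_mul_right ?_ h)
  exact (Nat.isCoprime_iff_coprime.2 (ZMod.val_coe_unit_coprime u)).symm

lemma HasLaurent.sum {K ι : Type*} [Field K] [Algebra ℚ K] (s : Finset ι)
    {g : ι → (K →ₐ[ℚ] ℂ) → ℂ → ℂ} (hg : ∀ i ∈ s, HasLaurent (g i)) :
    HasLaurent fun σ q => ∑ i ∈ s, g i σ q := by
  classical
  induction s using Finset.induction_on with
  | empty => exact (hasExpansion_C (0 : K)).hasLaurent.congr fun σ _ _ _ => by simp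
  | insert i s hi ih =>
    exact ((hg i (Finset.mem_insert_self i s)).add
      (ih fun j hj => hg j (Finset.mem_insert_of_mem hj))).congr fun _ _ _ _ =>
        Finset.sum_insert hi

lemma exists_intSeries {r : ℕ → ℚ} {d : ℕ} :
    ∃ c : ℤ → ℚ, (∀ m : ℤ, m < -d → c m = 0) ∧ ∀ q T : ℂ, q ≠ 0 →
      HasSum (fun m : ℕ => (r m : ℂ) * q ^ m) (q ^ d * T) →
        HasSum (fun m : ℤ => (c m : ℂ) * q ^ m) T := by
  refine ⟨fun m => if 0 ≤ m + d then r (m + d).toNat else 0,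
    fun m hm => if_neg (by omega), fun q T hq0 h => ?_⟩
  have hi : Function.Injective fun k : ℕ => (k : ℤ) - d := fun a b h => by
    simp only at h; omega
  refine (hi.hasSum_iff fun m hm => ?_).1 ?_
  · have h0 : ¬ 0 ≤ m + d := fun h0 => hm ⟨(m + d).toNat, by simp only; omega⟩
    simp [h0]
  · have h' := h.mul_left (q ^ d)⁻¹
    rw [inv_mul_cancel_left₀ (pow_ne_zero d hq0)] at h'
    refine h'.congr_fun fun k => ?_
    simp only [Function.comp, sub_add_cancel, Int.natCast_nonneg, if_true, Int.toNat_natCast]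
    rw [zpow_sub₀ hq0, zpow_natCast, zpow_natCast]
    ring

end Assembly

section Main

variable {N n : ℕ} {K : Type*} [Field K] [Algebra ℚ K]

lemma qq_pow_self (hN : 0 < N) (τ : ℂ) : qq N τ ^ N = exp (2 * Real.pi * I * τ) := by
  have hN' : (N : ℂ) ≠ 0 := by exact_mod_cast hN.ne'
  rw [qq, ← exp_nat_mul, mul_div_cancel₀ _ hN']

lemma qq_ne_zero (τ : ℂ) : qq N τ ≠ 0 := exp_ne_zero _

lemma norm_qq_lt_one (hN : 0 < N) {τ : ℂ} (hτ : 0 < τ.im) : ‖qq N τ‖ < 1 := by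
  have h := norm_nome_lt_one hτ
  rw [← qq_pow_self hN, norm_pow] at h
  exact (pow_lt_one_iff_of_nonneg (norm_nonneg _) hN.ne').1 h

lemma exp_mul_div_eq_qq_zpow (τ : ℂ) (U : ℤ) :
    exp (2 * Real.pi * I * (τ * (U / N))) = qq N τ ^ U := by
  rw [qq, ← exp_int_mul]
  congr 1
  ring

lemma exists_embedding_equiv [NeZero N] [IsCyclotomicExtension {N} ℚ K] {ζ : K}
    (hζ : IsPrimitiveRoot ζ N) :
    ∃ e : (ZMod N)ˣ ≃ (K →ₐ[ℚ] ℂ), ∀ u, e u ζ = zetaN N ^ (u : ZMod N).val := by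
  have hN : N ≠ 0 := NeZero.ne N
  have hz : IsPrimitiveRoot (zetaN N) N := Complex.isPrimitiveRoot_exp N hN
  have := IsCyclotomicExtension.finiteDimensional {N} ℚ K
  have hirr := Polynomial.cyclotomic.irreducible_rat (NeZero.pos N)
  let φ : (ZMod N)ˣ → (K →ₐ[ℚ] ℂ) := fun u =>
    (hζ.embeddingsEquivPrimitiveRoots ℂ hirr).symm ⟨zetaN N ^ (u : ZMod N).val,
      (mem_primitiveRoots (NeZero.pos N)).2 (hz.pow_of_coprime _ (ZMod.val_coe_unit_coprime u))⟩
  have hφ : ∀ u, φ u ζ = zetaN N ^ (u : ZMod N).val := fun u => by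
    rw [← hζ.embeddingsEquivPrimitiveRoots_apply_coe ℂ hirr, Equiv.apply_symm_apply]
  have hbij : Function.Bijective φ := by
    rw [Fintype.bijective_iff_injective_and_card]
    refine ⟨fun u v h => ?_, ?_⟩
    · have h1 : zetaN N ^ (u : ZMod N).val = zetaN N ^ (v : ZMod N).val := by
        rw [← hφ, ← hφ, h]
      exact Units.ext (ZMod.val_injective N
        (hz.pow_inj (ZMod.val_lt _) (ZMod.val_lt _) h1))
    · rw [ZMod.card_units_eq_totient, AlgHom.card,
        IsCyclotomicExtension.finrank K hirr]
  exact ⟨Equiv.ofBijective φ hbij, hφ⟩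

variable (K) in
lemma exists_laurent_Tfun (hN : 0 < N) [IsCyclotomicExtension {N} ℚ K]
    {A : Fin n → ℤ × ℤ × ℤ} (hA : ∀ i, memE N (A i))
    (F : MvPolynomial (Fin n) ℤ) {M : SNgroup N → SL(2, ℤ)} (hM : ∀ s, IsDiagLift N (M s) s) :
    ∃ (d : ℕ) (r : ℕ → ℚ), ∀ τ : ℂ, 0 < τ.im →
      HasSum (fun m : ℕ => (r m : ℂ) * qq N τ ^ m) (qq N τ ^ d * Tfun N A F M τ) := by
  classical
  have : NeZero N := ⟨hN.ne'⟩
  have := Fintype.ofFinite (SNgroup N)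
  have := IsCyclotomicExtension.finiteDimensional {N} ℚ K
  have hζ := IsCyclotomicExtension.zeta_spec N ℚ K
  generalize IsCyclotomicExtension.zeta N ℚ K = ζ at hζ
  obtain ⟨e, he⟩ := exists_embedding_equiv hζ
  obtain ⟨u, hu, hT⟩ := Tfun_eq_finsum_wpPoly hN A F hM
  obtain ⟨d, p, hp⟩ := hasLaurent_thetaPoly hA F (x := fun σ _ => σ ζ) fun b _ =>
    (hasLaurentUnit_thetaQ_const hN (y := ζ ^ b) (by
      rw [← zpow_natCast, zpow_comm ζ, zpow_natCast, hζ.pow_eq_one, one_zpow])).congr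
        fun σ q _ _ => by rw [map_zpow₀]
  let H := Subgroup.closure ({-1} : Set (ZMod N)ˣ)
  have hH : (Nat.card H : ℂ) ≠ 0 := by exact_mod_cast Nat.card_pos.ne'
  refine ⟨d, fun m => (Nat.card H : ℚ)⁻¹ * Algebra.trace ℚ K (p.coeff m),
    fun τ hτ => ?_⟩
  have hq := norm_qq_lt_one hN hτ
  have hwp : ∀ v : (ZMod N)ˣ, wpPoly A F τ ((((v : ZMod N).val : ℤ) : ℂ) / N) =
      thetaPoly A F (qq N τ ^ N) (e v ζ) := by
    intro v
    rw [wpPoly_eq_thetaPoly hA F hτ, qq_pow_self hN, he, zetaN, ← exp_nat_mul]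
    · congr 2
      push_cast
      ring
    · intro b hb
      have := not_inLat_div hN hτ (not_dvd_mul_unit_val v hb)
      rwa [Int.cast_mul, mul_div_assoc] at this
  have hsum : ∑ σ : K →ₐ[ℚ] ℂ, thetaPoly A F (qq N τ ^ N) (σ ζ) = Nat.card H * Tfun N A F M τ := by
    rw [← e.sum_comp, hT τ hτ, finsum_eq_sum_of_fintype, ← sum_mk_eq]
    refine Finset.sum_congr rfl fun v _ => ?_
    rw [← hwp]
    exact wpPoly_unit_congr A F hτ (hu _).symm
  have hs := (hasSum_sum (s := Finset.univ) fun σ _ => hp σ _ (qq_ne_zero τ) hq).mul_left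
    (Nat.card H : ℂ)⁻¹
  rw [← Finset.mul_sum, hsum, mul_left_comm, inv_mul_cancel_left₀ hH] at hs
  refine hs.congr_fun fun m => ?_
  rw [← Finset.sum_mul, ← trace_eq_sum_embeddings ℂ]
  push_cast
  simp [mul_assoc]

lemma exists_laurent_Tfun_moebius (hN : 0 < N) {A : Fin n → ℤ × ℤ × ℤ}
    (hA : ∀ i, memE N (A i)) (F : MvPolynomial (Fin n) ℤ) {M : SNgroup N → SL(2, ℤ)}
    (hM : ∀ s, IsDiagLift N (M s) s) :
    ∃ (d : ℕ) (r : ℕ → ℚ), ∀ τ : ℂ, 0 < τ.im →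
      HasSum (fun m : ℕ => (r m : ℂ) * qq N τ ^ m)
        (qq N τ ^ d * Tfun N A F M (moebius (Bmat 1 1 1 (-1)) τ)) := by
  classical
  have : NeZero N := ⟨hN.ne'⟩
  have := Fintype.ofFinite (SNgroup N)
  obtain ⟨u, hu, hT⟩ := Tfun_eq_finsum_wpPoly hN A F hM
  obtain ⟨d, p, hp⟩ := HasLaurent.sum (K := ℚ) (Finset.univ : Finset (SNgroup N)) fun s _ =>
    hasLaurent_thetaPoly hA F (x := fun _ q => q ^ ((u s : ZMod N).val : ℤ)) fun b hb =>
      (hasLaurentUnit_thetaQ_zpow hN (not_dvd_mul_unit_val (u s) hb)).congr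
        fun σ q _ _ => by rw [mul_comm, zpow_mul]
  refine ⟨d, fun m => p.coeff m, fun τ hτ => ?_⟩
  have hs := hp (Algebra.ofId ℚ ℂ) _ (qq_ne_zero τ) (norm_qq_lt_one hN hτ)
  refine (congrArg (fun T => HasSum _ (qq N τ ^ d * T)) ?_).mpr hs
  rw [hT _ (im_moebius_Bmat_pos hτ), finsum_eq_sum_of_fintype]
  refine Finset.sum_congr rfl fun s _ => ?_
  have hscale : ∀ z, wpPoly A F (moebius (Bmat 1 1 1 (-1)) τ) z = wpPoly A F τ (τ * z) := by
    intro z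
    simp only [wpPoly, wpRatio_moebius_Bmat hτ, mul_left_comm]
  rw [hscale, wpPoly_eq_thetaPoly hA F hτ, qq_pow_self hN, exp_mul_div_eq_qq_zpow]
  intro b hb
  have := not_inLat_mul_div hN hτ (not_dvd_mul_unit_val (u s) hb)
  rwa [Int.cast_mul, mul_div_assoc, mul_left_comm] at this

end Main

/-- Proposition 3.4 of the paper. `T_{𝔄,F}` and `T_{𝔄,F}∘B(1,1,1,−1)` have
rational Fourier coefficients. -/
theorem stmt13 (N : ℕ) (hN : 0 < N) {n : ℕ} (A : Fin n → ℤ × ℤ × ℤ)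
    (hA : ∀ i, memE N (A i)) (F : MvPolynomial (Fin n) ℤ)
    (M : SNgroup N → SL(2, ℤ))
    (hM : ∀ s, M s ∈ CongruenceSubgroup.Gamma0 N ∧ IsDiagLift N (M s) s) :
    ∃ (n₀ : ℤ) (c c' : ℤ → ℚ),
      (∀ m : ℤ, m < n₀ → c m = 0) ∧ (∀ m : ℤ, m < n₀ → c' m = 0) ∧
      ∀ τ : ℂ, 0 < τ.im →
        (Summable (fun m : ℤ => (c m : ℂ) * qq N τ ^ m) ∧
          Tfun N A F M τ = ∑' m : ℤ, (c m : ℂ) * qq N τ ^ m) ∧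
        (Summable (fun m : ℤ => (c' m : ℂ) * qq N τ ^ m) ∧
          Tfun N A F M (moebius (Bmat 1 1 1 (-1)) τ) =
            ∑' m : ℤ, (c' m : ℂ) * qq N τ ^ m) := by
  have : NeZero N := ⟨hN.ne'⟩
  have : IsCyclotomicExtension {N} ℚ (CyclotomicField N ℚ) :=
    CyclotomicField.isCyclotomicExtension N ℚ
  obtain ⟨d, r, hr⟩ := exists_laurent_Tfun (CyclotomicField N ℚ) hN hA F fun s => (hM s).2
  obtain ⟨d', r', hr'⟩ := exists_laurent_Tfun_moebius hN hA F fun s => (hM s).2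
  obtain ⟨c, hc0, hc⟩ := exists_intSeries (r := r) (d := d)
  obtain ⟨c', hc0', hc'⟩ := exists_intSeries (r := r') (d := d')
  refine ⟨min (-d) (-d'), c, c', fun m hm => hc0 m (lt_min_iff.1 hm).1,
    fun m hm => hc0' m (lt_min_iff.1 hm).2, fun τ hτ => ?_⟩
  have h := hc _ _ (qq_ne_zero τ) (hr τ hτ)
  have h' := hc' _ _ (qq_ne_zero τ) (hr' τ hτ)
  exact ⟨⟨h.summable, h.tsum_eq.symm⟩, h'.summable, h'.tsum_eq.symm⟩
end

section
/- Let N be an odd positive integer and ζ = e^{2πi/N}. (i) For integers a, b with gcd(ab(a−b)(a+b), N) = 1, the element θ_{a,b} = ζ^a(1−ζ^{b−a})(1−ζ^{b+a})/((1−ζ^a)²(1−ζ^b)²) satisfies θ_{a,b}⁻¹ ∈ ℤ[ζ]. (ii) For 𝔞 = [a₁,a₂,a₃] ∈ 𝔈₂, the quotient θ_{a₁,a₃}/θ_{a₂,a₃} = ζ^{a₁−a₂}·((1−ζ^{a₂})/(1−ζ^{a₁}))²·(1−ζ^{a₃−a₁})(1−ζ^{a₃+a₁})/((1−ζ^{a₃−a₂})(1−ζ^{a₃+a₂}))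 is a unit of the ring ℤ[ζ]. -/
open scoped MatrixGroups
open Complex

theorem zetaN_isPrimitiveRoot {N : ℕ} (hN : N ≠ 0) : IsPrimitiveRoot (zetaN N) N :=
  Complex.isPrimitiveRoot_exp N hN

theorem IsPrimitiveRoot.zpow_mem_adjoin {ζ : ℂ} {N : ℕ} (h : IsPrimitiveRoot ζ N) (hN : N ≠ 0)
    (x : ℤ) : ζ ^ x ∈ Algebra.adjoin ℤ ({ζ} : Set ℂ) := by
  have hN' : (N : ℤ) ≠ 0 := by exact_mod_cast hN
  have hx : ζ ^ x = ζ ^ (x % N).toNat := by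
    conv_lhs => rw [← Int.mul_ediv_add_emod x N]
    rw [zpow_add₀ (h.ne_zero hN), zpow_mul, zpow_natCast, h.pow_eq_one, one_zpow, one_mul,
      ← zpow_natCast, Int.toNat_of_nonneg (Int.emod_nonneg _ hN')]
  rw [hx]
  exact pow_mem (Algebra.self_mem_adjoin_singleton ℤ ζ) _

theorem IsPrimitiveRoot.one_sub_zpow_div_mem_adjoin {ζ : ℂ} {N : ℕ} (h : IsPrimitiveRoot ζ N)
    (hN : N ≠ 0) {c : ℤ} (hc : IsCoprime c (N : ℤ)) (x : ℤ) :
    (1 - ζ ^ x) / (1 - ζ ^ c) ∈ Algebra.adjoin ℤ ({ζ} : Set ℂ) := by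
  have hN' : (N : ℤ) ≠ 0 := by exact_mod_cast hN
  have hζ := h.ne_zero hN
  obtain ⟨u, v, huv⟩ := hc
  set m := (x * u) % N with hm
  have hx : ζ ^ x = (ζ ^ c) ^ m.toNat := by
    have hmx : x = c * m + N * (c * ((x * u) / N) + x * v) := by
      have := Int.mul_ediv_add_emod (x * u) N
      linear_combination -x * huv - c * this
    rw [← zpow_natCast, Int.toNat_of_nonneg (Int.emod_nonneg _ hN'), ← zpow_mul]
    conv_lhs => rw [hmx, zpow_add₀ hζ, zpow_mul ζ N, zpow_natCast, h.pow_eq_one, one_zpow, mul_one]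
  by_cases h1 : 1 - ζ ^ c = 0
  · rw [h1, div_zero]
    exact zero_mem _
  · rw [hx, ← mul_neg_geom_sum, mul_div_cancel_left₀ _ h1]
    exact sum_mem fun i _ => pow_mem (h.zpow_mem_adjoin hN c) i

theorem IsPrimitiveRoot.one_sub_zpow_ne_zero {ζ : ℂ} {N : ℕ} (h : IsPrimitiveRoot ζ N)
    (hN : N ≠ 1) {c : ℤ} (hc : IsCoprime c (N : ℤ)) : 1 - ζ ^ c ≠ 0 := by
  intro h0
  have hdvd : (N : ℤ) ∣ c := (h.zpow_eq_one_iff_dvd c).1 (sub_eq_zero.1 h0).symm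
  have := Int.isUnit_iff_natAbs_eq.1 (hc.isUnit_of_dvd' hdvd dvd_rfl)
  exact hN (by simpa using this)

/-- The displayed expression for a quotient of two values of `theta`. -/
theorem theta_div_theta {ζ : ℂ} (hζ : ζ ≠ 0) {a b c : ℤ} (hc : 1 - ζ ^ c ≠ 0) :
    theta ζ a c / theta ζ b c = ζ ^ (a - b) * ((1 - ζ ^ b) / (1 - ζ ^ a)) ^ 2
      * ((1 - ζ ^ (c - a)) * (1 - ζ ^ (c + a)) / ((1 - ζ ^ (c - b)) * (1 - ζ ^ (c + b)))) := by
  rw [theta, theta, zpow_sub₀ hζ a b]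
  generalize 1 - ζ ^ (c - a) = s
  generalize 1 - ζ ^ (c + a) = t
  generalize 1 - ζ ^ (c - b) = u
  generalize 1 - ζ ^ (c + b) = v
  generalize 1 - ζ ^ c = w at *
  field_simp

theorem theta_div_theta_mem_adjoin {ζ : ℂ} {N : ℕ} (h : IsPrimitiveRoot ζ N) (hN : N ≠ 0)
    {a b c : ℤ} (hc : 1 - ζ ^ c ≠ 0) (ha : IsCoprime a (N : ℤ))
    (hbc : IsCoprime (c - b) (N : ℤ)) (hbc' : IsCoprime (c + b) (N : ℤ)) :
    theta ζ a c / theta ζ b c ∈ Algebra.adjoin ℤ ({ζ} : Set ℂ) := by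
  rw [theta_div_theta (h.ne_zero hN) hc, mul_div_mul_comm]
  exact mul_mem (mul_mem (h.zpow_mem_adjoin hN _)
    (pow_mem (h.one_sub_zpow_div_mem_adjoin hN ha b) 2))
    (mul_mem (h.one_sub_zpow_div_mem_adjoin hN hbc _) (h.one_sub_zpow_div_mem_adjoin hN hbc' _))

theorem inv_theta_mem_adjoin {ζ : ℂ} {N : ℕ} (h : IsPrimitiveRoot ζ N) (hN : N ≠ 0) {a b : ℤ}
    (hd : IsCoprime (b - a) (N : ℤ)) (hs : IsCoprime (b + a) (N : ℤ)) :
    (theta ζ a b)⁻¹ ∈ Algebra.adjoin ℤ ({ζ} : Set ℂ) := by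
  have key : (theta ζ a b)⁻¹ = ζ ^ (-a) * (1 - ζ ^ a) * (1 - ζ ^ b) *
      (((1 - ζ ^ a) / (1 - ζ ^ (b - a))) * ((1 - ζ ^ b) / (1 - ζ ^ (b + a)))) := by
    rw [theta, zpow_neg, inv_div]
    simp only [div_eq_mul_inv, mul_inv]
    ring
  have hmem (x : ℤ) := h.zpow_mem_adjoin hN x
  rw [key]
  exact mul_mem (mul_mem (mul_mem (hmem _) (sub_mem (one_mem _) (hmem a)))
    (sub_mem (one_mem _) (hmem b)))
    (mul_mem (h.one_sub_zpow_div_mem_adjoin hN hd a) (h.one_sub_zpow_div_mem_adjoin hN hs b))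

/-- (i) `θ_{a,b}⁻¹ ∈ ℤ[ζ]` when `gcd(ab(a−b)(a+b),N) = 1`;
(ii) for `𝔞 ∈ 𝔈₂`, `θ_{a₁,a₃}/θ_{a₂,a₃}` equals the displayed explicit expression and is a
unit of `ℤ[ζ]`. -/
theorem stmt14 (N : ℕ) (hN : 0 < N) (hodd : Odd N) :
    (∀ a b : ℤ, IsCoprime (a * b * (a - b) * (a + b)) (N : ℤ) →
      (theta (zetaN N) a b)⁻¹ ∈ Algebra.adjoin ℤ ({zetaN N} : Set ℂ)) ∧
    (∀ a : ℤ × ℤ × ℤ, memE2 N a →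
      theta (zetaN N) a.1 a.2.2 / theta (zetaN N) a.2.1 a.2.2 =
          zetaN N ^ (a.1 - a.2.1) * ((1 - zetaN N ^ a.2.1) / (1 - zetaN N ^ a.1)) ^ 2
            * ((1 - zetaN N ^ (a.2.2 - a.1)) * (1 - zetaN N ^ (a.2.2 + a.1))
              / ((1 - zetaN N ^ (a.2.2 - a.2.1)) * (1 - zetaN N ^ (a.2.2 + a.2.1)))) ∧
        theta (zetaN N) a.1 a.2.2 / theta (zetaN N) a.2.1 a.2.2
          ∈ Algebra.adjoin ℤ ({zetaN N} : Set ℂ) ∧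
        (theta (zetaN N) a.1 a.2.2 / theta (zetaN N) a.2.1 a.2.2)⁻¹
          ∈ Algebra.adjoin ℤ ({zetaN N} : Set ℂ)) := by
  have h := zetaN_isPrimitiveRoot hN.ne'
  have hsub {x y : ℤ} (hxy : IsCoprime (x - y) (N : ℤ)) : IsCoprime (y - x) (N : ℤ) := by
    simpa using hxy.neg_left
  have hadd {x y : ℤ} (hxy : IsCoprime (x + y) (N : ℤ)) : IsCoprime (y + x) (N : ℤ) := by
    rwa [add_comm]
  refine ⟨fun a b hab => ?_, ?_⟩
  · exact inv_theta_mem_adjoin h hN.ne' (hsub hab.of_mul_left_left.of_mul_left_right)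
      (hadd hab.of_mul_left_right)
  · rintro ⟨a, b, c⟩ ⟨⟨⟨ha, -, -, ha', -⟩, habc⟩, h1, h2, h3, h4⟩
    dsimp only at *
    have hc : 1 - zetaN N ^ c ≠ 0 :=
      h.one_sub_zpow_ne_zero (by omega) habc.of_mul_left_right
    have hab := habc.of_mul_left_left
    refine ⟨theta_div_theta (h.ne_zero hN.ne') hc, ?_, ?_⟩
    · exact theta_div_theta_mem_adjoin h hN.ne' hc hab.of_mul_left_left (hsub h3) (hadd h4)
    · rw [inv_div]
      exact theta_div_theta_mem_adjoin h hN.ne' hc hab.of_mul_left_right (hsub h1) (hadd h2)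
end
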